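/- arXiv:1401.6268 — 6 statements merged into one kernel-verified Lean document; each statement's English description precedes it below -/
import Mathlib

section
/- For every integer k ≥ 1, the ℚ-dimension of gr^k(J) := J^k/J^{k+1} equals Σ_{l=0}^{k} C(n, 2l)·C(n + k − l − 1, k − l), where C(a,b) denotes the binomial coefficient. -/
set_option synthInstance.maxHeartbeats 1000000
set_option maxHeartbeats 1000000

noncomputable section

abbrev SL2 : Type := Matrix.SpecialLinearGroup (Fin 2) ℂ

/-- The free abelian group of rank `n`, written multiplicatively. -/
abbrev H (n : ℕ) : Type := Multiplicative (Fin n → ℤ)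

/-- The algebra of complex-valued functions on the representation space `R(H)`. -/
abbrev FR (n : ℕ) : Type := (H n →* SL2) → ℂ

/-- The standard basis element `x_i` of `H`. -/
def xgen (n : ℕ) (i : Fin n) : H n := Multiplicative.ofAdd (Pi.single i 1)

/-- The Fricke character `tr x`. -/
def trc {n : ℕ} (x : H n) : FR n :=
  fun ρ => Matrix.trace ((ρ x : Matrix (Fin 2) (Fin 2) ℂ))

/-- The ring of Fricke characters `𝔛_ℚ(H)`. -/
def Xring (n : ℕ) : Subalgebra ℚ (FR n) :=
  Algebra.adjoin ℚ {f : FR n | ∃ x : H n, f = trc x}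

/-- The ideal `J` generated by all `tr' x = tr x - 2`. -/
def Jideal (n : ℕ) : Ideal (Xring n) :=
  Ideal.span {f : Xring n | ∃ x : H n, (f : FR n) = trc x - 2}

/-- `tr' x = tr x - 2` as an element of `𝔛_ℚ(H)`. -/
def trc' {n : ℕ} (x : H n) : Xring n :=
  ⟨trc x - 2, sub_mem (Algebra.subset_adjoin ⟨x, rfl⟩) (ofNat_mem _ 2)⟩

/-- The graded quotient `gr^k(J) = J^k / J^{k+1}`, realized as the image of `J^k` in the
ℚ-module quotient `𝔛_ℚ(H) / J^{k+1}`. -/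
def grJ (n k : ℕ) : Submodule ℚ (Xring n ⧸ Submodule.restrictScalars ℚ (Jideal n ^ (k + 1))) :=
  (Submodule.restrictScalars ℚ (Jideal n ^ k)).map
    (Submodule.restrictScalars ℚ (Jideal n ^ (k + 1))).mkQ

/-- Even coefficients of `(1 - X)⁻ⁿ = (1 + X)ⁿ (1 - X²)⁻ⁿ`. -/
theorem sum_choose_two_mul_mul_choose (d k : ℕ) :
    ∑ l ∈ Finset.range (k + 1), (d + 1).choose (2 * l) * (d + (k - l)).choose d
      = (d + 2 * k).choose d := by
  let G : PowerSeries ℚ := PowerSeries.mk fun m => ((d + m).choose d : ℚ)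
  have hG : G * (1 - PowerSeries.X) ^ (d + 1) = 1 :=
    PowerSeries.mk_add_choose_mul_one_sub_pow_eq_one ℚ d
  have hE : PowerSeries.expand 2 two_ne_zero G * (1 - PowerSeries.X ^ 2) ^ (d + 1) = 1 := by
    simpa using congrArg (PowerSeries.expand 2 two_ne_zero) hG
  have key : (1 + PowerSeries.X) ^ (d + 1) * PowerSeries.expand 2 two_ne_zero G = G := by
    have h2 : (1 - PowerSeries.X ^ 2 : PowerSeries ℚ)
      = (1 - PowerSeries.X) * (1 + PowerSeries.X) := by ring
    rw [h2, mul_pow] at hE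
    linear_combination G * hE - (1 + PowerSeries.X) ^ (d + 1) *
      PowerSeries.expand 2 two_ne_zero G * hG
  have hb (i : ℕ) : PowerSeries.coeff i ((1 + PowerSeries.X : PowerSeries ℚ) ^ (d + 1))
      = (d + 1).choose i := by
    rw [← Polynomial.coeff_one_add_X_pow, ← Polynomial.coeff_coe]
    simp
  have := congrArg (PowerSeries.coeff (2 * k)) key
  rw [PowerSeries.coeff_mul] at this
  have hc : PowerSeries.coeff (2 * k) G = ((d + 2 * k).choose d : ℚ) := by simp [G]
  rw [hc] at this
  have h3 : (∑ l ∈ Finset.range (k + 1), (d + 1).choose (2 * l) * (d + (k - l)).choose d : ℚ)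
      = ((d + 2 * k).choose d : ℚ) := by
    rw [← this]
    refine Finset.sum_of_injOn (fun l => (2 * l, 2 * (k - l))) ?_ ?_ ?_ ?_
    · intro a _ b _ h
      simp only [Prod.mk.injEq] at h
      lia
    · intro a ha
      simp only [Finset.coe_range, Set.mem_Iio, Finset.mem_coe,
        Finset.HasAntidiagonal.mem_antidiagonal] at *
      lia
    · rintro ⟨i, j⟩ hij hn
      rw [PowerSeries.coeff_expand_of_not_dvd, mul_zero]
      rintro ⟨c, rfl⟩
      simp only [Finset.HasAntidiagonal.mem_antidiagonal] at hij
      refine hn ⟨k - c, by simp, ?_⟩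
      simp only [Prod.mk.injEq]
      lia
    · intro l _
      simp [hb, G]
  exact_mod_cast h3

theorem finrank_homogeneousSubmodule (d m : ℕ) :
    Module.finrank ℚ (MvPolynomial.homogeneousSubmodule (Fin (d + 1)) ℚ m)
      = (d + m).choose d := by
  rw [MvPolynomial.homogeneousSubmodule_eq_finsupp_supported]
  change Module.finrank ℚ (MvPolynomial.restrictSupport ℚ {e | e.degree = m}) = _
  rw [Module.finrank_eq_nat_card_basis
    (MvPolynomial.basisRestrictSupport ℚ {e : Fin (d + 1) →₀ ℕ | e.degree = m})]
  have : {e : Fin (d + 1) →₀ ℕ | e.degree = m}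
      = ((Finset.univ : Finset (Fin (d + 1))).finsuppAntidiag m : Set (Fin (d + 1) →₀ ℕ)) := by
    ext e
    simp [Finsupp.degree_eq_sum]
  rw [this, Nat.card_coe_set_eq, Set.ncard_coe_finset,
    Finset.card_finsuppAntidiag_nat_eq_choose, Finset.card_univ, Fintype.card_fin,
    show d + 1 + m - 1 = d + m by lia, Nat.choose_symm_add]

/-- The pairing of `x = ∏ x_i ^ a_i` with `v`, namely `∑ a_i v_i`. -/
def pairing {n : ℕ} (x : H n) (v : Fin n → ℂ) : ℂ := ∑ i, (Multiplicative.toAdd x i : ℂ) * v i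

theorem pairing_mul {n : ℕ} (x y : H n) (v : Fin n → ℂ) :
    pairing (x * y) v = pairing x v + pairing y v := by
  simp [pairing, add_mul, Finset.sum_add_distrib]

theorem pairing_one {n : ℕ} (v : Fin n → ℂ) : pairing (1 : H n) v = 0 := by
  simp [pairing]

theorem pairing_inv {n : ℕ} (x : H n) (v : Fin n → ℂ) : pairing x⁻¹ v = -pairing x v := by
  simp [pairing]

theorem pairing_smul {n : ℕ} (x : H n) (z : ℂ) (v : Fin n → ℂ) :
    pairing x (z • v) = z * pairing x v := by
  simp only [pairing, Finset.mul_sum, Pi.smul_apply, smul_eq_mul]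
  exact Finset.sum_congr rfl fun i _ => by ring

theorem pairing_xgen {n : ℕ} (i : Fin n) (v : Fin n → ℂ) : pairing (xgen n i) v = v i := by
  simp [pairing, xgen, Pi.single_apply]

theorem closure_range_xgen (n : ℕ) : Subgroup.closure (Set.range (xgen n)) = ⊤ := by
  refine eq_top_iff.mpr fun x _ => ?_
  have hx : x = ∏ i, xgen n i ^ (Multiplicative.toAdd x i) := by
    apply Multiplicative.toAdd.injective
    ext j
    simp [xgen, toAdd_prod, Pi.single_apply]
  rw [hx]
  exact Subgroup.prod_mem _ fun i _ =>
    Subgroup.zpow_mem _ (Subgroup.subset_closure (Set.mem_range_self i)) _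

/-- The diagonal representation `x ↦ diag(exp ⟨x, v⟩, exp (-⟨x, v⟩))`. -/
def diagRep {n : ℕ} (v : Fin n → ℂ) : H n →* SL2 where
  toFun x := ⟨!![Complex.exp (pairing x v), 0; 0, Complex.exp (-pairing x v)], by
    simp [Matrix.det_fin_two, ← Complex.exp_add]⟩
  map_one' := by
    ext i j
    fin_cases i <;> fin_cases j <;> simp [pairing_one]
  map_mul' x y := by
    refine Subtype.ext (Eq.trans ?_ (Matrix.SpecialLinearGroup.coe_mul _ _).symm)
    simp [pairing_mul, Complex.exp_add, mul_comm]

theorem trc_diagRep {n : ℕ} (x : H n) (v : Fin n → ℂ) :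
    trc x (diagRep v) = Complex.exp (pairing x v) + Complex.exp (-pairing x v) :=
  Matrix.trace_fin_two_of ..

theorem trace_eq_of_mulVec_eq_smul {A : Matrix (Fin 2) (Fin 2) ℂ} (hA : A.det = 1)
    {u : Fin 2 → ℂ} (hu : u ≠ 0) {c : ℂ} (h : A.mulVec u = c • u) :
    c ≠ 0 ∧ A.trace = c + c⁻¹ := by
  have h0 := congrFun h 0
  have h1 := congrFun h 1
  simp only [Matrix.mulVec, dotProduct, Fin.sum_univ_two, Pi.smul_apply, smul_eq_mul] at h0 h1
  rw [Matrix.det_fin_two] at hA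
  have key : c * A.trace = c ^ 2 + 1 := by
    rw [Matrix.trace_fin_two]
    have hu' : u 0 ≠ 0 ∨ u 1 ≠ 0 := by
      by_contra! hc
      exact hu (funext fun i => by fin_cases i <;> simp [hc.1, hc.2])
    rcases hu' with hu' | hu'
    · apply mul_right_cancel₀ hu'
      linear_combination (c - A 1 1) * h0 + A 0 1 * h1 + u 0 * hA
    · apply mul_right_cancel₀ hu'
      linear_combination (c - A 0 0) * h1 + A 1 0 * h0 + u 1 * hA
  have hc : c ≠ 0 := by
    rintro rfl
    simp at key
  refine ⟨hc, ?_⟩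
  field_simp
  linear_combination key

theorem exists_mulVec_eq_smul (A : Matrix (Fin 2) (Fin 2) ℂ) :
    ∃ u : Fin 2 → ℂ, u ≠ 0 ∧ ∃ c : ℂ, A.mulVec u = c • u := by
  obtain ⟨c, hc⟩ := Module.End.exists_eigenvalue (Matrix.toLin' A)
  obtain ⟨u, hu⟩ := hc.exists_hasEigenvector
  exact ⟨u, hu.2, c, by simpa using hu.apply_eq_smul⟩

theorem mulVec_eq_smul_of_commute {A B : Matrix (Fin 2) (Fin 2) ℂ} (hAB : A * B = B * A)
    (hA : ¬ ∃ a : ℂ, A = a • 1) {u : Fin 2 → ℂ} (hu : u ≠ 0) {c : ℂ} (h : A.mulVec u = c • u) :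
    ∃ b : ℂ, B.mulVec u = b • u := by
  by_contra! hB
  have hli : LinearIndependent ℂ ![u, B.mulVec u] := by
    rw [LinearIndependent.pair_iff' hu]
    exact fun a ha => hB a ha.symm
  let b := basisOfLinearIndependentOfCardEqFinrank hli (by simp)
  refine hA ⟨c, ?_⟩
  apply Matrix.toLin'.injective
  refine b.ext fun i => ?_
  fin_cases i
  · simpa [b] using h
  · rw [coe_basisOfLinearIndependentOfCardEqFinrank]
    change A.mulVec (B.mulVec u) = (c • (1 : Matrix (Fin 2) (Fin 2) ℂ)).mulVec (B.mulVec u)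
    rw [Matrix.mulVec_mulVec, hAB, ← Matrix.mulVec_mulVec, h, Matrix.mulVec_smul,
      Matrix.smul_mulVec, Matrix.one_mulVec]

/-- A representation of an abelian group in `SL(2, ℂ)` has a common eigenvector. -/
theorem exists_common_eigenvector {n : ℕ} (ρ : H n →* SL2) :
    ∃ u : Fin 2 → ℂ, u ≠ 0 ∧
      ∀ x, ∃ c : ℂ, (ρ x : Matrix (Fin 2) (Fin 2) ℂ).mulVec u = c • u := by
  by_cases hs : ∀ x, ∃ a : ℂ, (ρ x : Matrix (Fin 2) (Fin 2) ℂ) = a • 1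
  · refine ⟨![1, 0], fun h => by simpa using congrFun h 0, fun x => ?_⟩
    obtain ⟨a, ha⟩ := hs x
    exact ⟨a, by simp [ha]⟩
  · push Not at hs
    obtain ⟨y, hy⟩ := hs
    obtain ⟨u, hu, c, hc⟩ := exists_mulVec_eq_smul (ρ y : Matrix (Fin 2) (Fin 2) ℂ)
    refine ⟨u, hu, fun x => mulVec_eq_smul_of_commute ?_ (by simpa using hy) hu hc⟩
    have := congrArg (Subtype.val) (show ρ y * ρ x = ρ x * ρ y by
      rw [← map_mul, ← map_mul, mul_comm])
    simpa using this

/-- Every representation has the same traces as a diagonal one. -/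
theorem exists_trc_eq_trc_diagRep {n : ℕ} (ρ : H n →* SL2) :
    ∃ v : Fin n → ℂ, ∀ x : H n, trc x ρ = trc x (diagRep v) := by
  obtain ⟨u, hu, hc⟩ := exists_common_eigenvector ρ
  choose c hc using hc
  have hc0 (x : H n) := trace_eq_of_mulVec_eq_smul (ρ x).2 hu (hc x)
  have hmul (x y : H n) : c (x * y) = c x * c y := by
    have h := hc (x * y)
    rw [map_mul, Matrix.SpecialLinearGroup.coe_mul, ← Matrix.mulVec_mulVec, hc y,
      Matrix.mulVec_smul, hc x, smul_smul] at h
    rw [mul_comm (c x)]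
    exact (smul_left_injective ℂ hu h).symm
  have hone : c 1 = 1 := by
    have h := hmul 1 1
    rw [one_mul] at h
    exact (mul_eq_left₀ (hc0 1).1).mp h.symm
  let χ : H n →* ℂ := { toFun := c, map_one' := hone, map_mul' := hmul }
  refine ⟨fun i => Complex.log (c (xgen n i)), fun x => ?_⟩
  let χ' : H n →* ℂ :=
    { toFun := fun x => Complex.exp (pairing x fun i => Complex.log (c (xgen n i)))
      map_one' := by simp [pairing_one]
      map_mul' := fun x y => by rw [pairing_mul, Complex.exp_add] }
  have hχ : χ = χ' := by
    refine MonoidHom.eq_of_eqOn_dense (closure_range_xgen n) ?_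
    rintro _ ⟨i, rfl⟩
    simp [χ, χ', pairing_xgen, Complex.exp_log (hc0 _).1]
  have hx : c x = Complex.exp (pairing x fun i => Complex.log (c (xgen n i))) :=
    DFunLike.congr_fun hχ x
  rw [trc_diagRep, Complex.exp_neg, ← hx]
  exact (hc0 x).2

/-- The trace `tr x` as an element of `𝔛_ℚ(H)`. -/
def trX {n : ℕ} (x : H n) : Xring n := ⟨trc x, Algebra.subset_adjoin ⟨x, rfl⟩⟩

theorem trc'_eq {n : ℕ} (x : H n) : trc' x = trX x - 2 := rfl

theorem trc'_mem_Jideal {n : ℕ} (x : H n) : trc' x ∈ Jideal n :=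
  Ideal.subset_span ⟨x, rfl⟩

/-- Restriction of Fricke characters to the diagonal representations. -/
def restr (n : ℕ) : Xring n →ₐ[ℚ] ((Fin n → ℂ) → ℂ) :=
  AlgHom.pi fun v => (Pi.evalAlgHom ℚ (fun _ : H n →* SL2 => ℂ) (diagRep v)).comp (Xring n).val

theorem restr_apply {n : ℕ} (f : Xring n) (v : Fin n → ℂ) :
    restr n f v = (f : FR n) (diagRep v) := rfl

theorem restr_trX {n : ℕ} (x : H n) (v : Fin n → ℂ) :
    restr n (trX x) v = Complex.exp (pairing x v) + Complex.exp (-pairing x v) :=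
  trc_diagRep x v

theorem restr_injective (n : ℕ) : Function.Injective (restr n) := by
  intro f g hfg
  apply Subtype.ext
  funext ρ
  obtain ⟨v, hv⟩ := exists_trc_eq_trc_diagRep ρ
  have key (f : FR n) (hf : f ∈ Xring n) : f ρ = f (diagRep v) := by
    induction hf using Algebra.adjoin_induction with
    | mem f hf => obtain ⟨x, rfl⟩ := hf; exact hv x
    | algebraMap c => rfl
    | add f g _ _ hf hg => simp [hf, hg]
    | mul f g _ _ hf hg => simp [hf, hg]
  rw [key f f.2, key g g.2]
  exact congrFun hfg v

/-- The algebra homomorphism sending the variable `X_i` to `v ↦ exp v_i - exp (-v_i)`. -/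
def sinhHom (n : ℕ) : MvPolynomial (Fin n) ℚ →ₐ[ℚ] ((Fin n → ℂ) → ℂ) :=
  MvPolynomial.aeval fun i v => Complex.exp (v i) - Complex.exp (-v i)

theorem sinhHom_X {n : ℕ} (i : Fin n) (v : Fin n → ℂ) :
    sinhHom n (MvPolynomial.X i) v = Complex.exp (v i) - Complex.exp (-v i) := by
  simp [sinhHom]

theorem sinhHom_apply {n : ℕ} (P : MvPolynomial (Fin n) ℚ) (v : Fin n → ℂ) :
    sinhHom n P v = MvPolynomial.aeval (fun i => Complex.exp (v i) - Complex.exp (-v i)) P := by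
  have : (Pi.evalAlgHom ℚ (fun _ : Fin n → ℂ => ℂ) v).comp (sinhHom n)
      = MvPolynomial.aeval (fun i => Complex.exp (v i) - Complex.exp (-v i)) := by
    ext i
    simp [sinhHom]
  exact DFunLike.congr_fun this P

/-- Fricke characters which are homogeneous polynomials of degree `2k` in the functions
`exp v_i - exp (-v_i)`. -/
def homChar (n k : ℕ) : Submodule ℚ (Xring n) :=
  ((MvPolynomial.homogeneousSubmodule (Fin n) ℚ (2 * k)).map (sinhHom n).toLinearMap).comap
    (restr n).toLinearMap

theorem mem_homChar {n k : ℕ} {f : Xring n} :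
    f ∈ homChar n k ↔
      ∃ P : MvPolynomial (Fin n) ℚ, P.IsHomogeneous (2 * k) ∧ sinhHom n P = restr n f := by
  simp [homChar]

theorem mul_mem_homChar {n k l : ℕ} {f g : Xring n} (hf : f ∈ homChar n k)
    (hg : g ∈ homChar n l) : f * g ∈ homChar n (k + l) := by
  rw [mem_homChar] at *
  obtain ⟨P, hP, hPf⟩ := hf
  obtain ⟨Q, hQ, hQg⟩ := hg
  exact ⟨P * Q, by rw [mul_add]; exact hP.mul hQ, by rw [map_mul, map_mul, hPf, hQg]⟩

theorem algebraMap_mem_homChar {n : ℕ} (c : ℚ) : algebraMap ℚ (Xring n) c ∈ homChar n 0 :=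
  mem_homChar.mpr ⟨MvPolynomial.C c, MvPolynomial.isHomogeneous_C _ c, by
    rw [← MvPolynomial.algebraMap_eq, AlgHom.commutes, AlgHom.commutes]⟩

/-- The symmetric function `tr (x y) - tr (x y⁻¹)`, which is bilinear modulo `J ^ 2`. -/
def polar {n : ℕ} (x y : H n) : Xring n := trX (x * y) - trX (x * y⁻¹)

theorem restr_polar {n : ℕ} (x y : H n) (v : Fin n → ℂ) :
    restr n (polar x y) v =
      (Complex.exp (pairing x v) - Complex.exp (-pairing x v)) *
      (Complex.exp (pairing y v) - Complex.exp (-pairing y v)) := by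
  simp only [polar, map_sub, Pi.sub_apply, restr_trX, pairing_mul, pairing_inv, neg_add,
    Complex.exp_add, neg_neg]
  ring

theorem polar_mem_Jideal {n : ℕ} (x y : H n) : polar x y ∈ Jideal n := by
  have : polar x y = trc' (x * y) - trc' (x * y⁻¹) := by simp only [polar, trc'_eq]; ring
  rw [this]
  exact sub_mem (trc'_mem_Jideal _) (trc'_mem_Jideal _)

theorem polar_comm {n : ℕ} (x y : H n) : polar x y = polar y x := by
  apply restr_injective
  funext v
  simp only [restr_polar, mul_comm]

theorem polar_one_left {n : ℕ} (y : H n) : polar 1 y = 0 := by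
  apply restr_injective
  funext v
  simp [restr_polar, pairing_one]

theorem polar_inv_left {n : ℕ} (x y : H n) : polar x⁻¹ y = -polar x y := by
  apply restr_injective
  funext v
  simp only [restr_polar, pairing_inv, map_neg, Pi.neg_apply, neg_neg]
  ring

theorem polar_mul_left {n : ℕ} (x y z : H n) :
    polar (x * y) z = polar x z + polar y z
      + (1 / 2 : ℚ) • (trc' x * polar y z + trc' y * polar x z) := by
  apply restr_injective
  funext v
  simp only [map_add, map_smul, map_mul, trc'_eq, map_sub, map_ofNat, Pi.add_apply, Pi.mul_apply,
    Pi.smul_apply, Pi.sub_apply, Pi.ofNat_apply, restr_polar, restr_trX, pairing_mul, neg_add,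
    Complex.exp_add, Rat.smul_def]
  push_cast
  ring

theorem polar_self {n : ℕ} (x : H n) : polar x x = (4 : ℚ) • trc' x + trc' x * trc' x := by
  apply restr_injective
  funext v
  have h : Complex.exp (pairing x v) * Complex.exp (-pairing x v) = 1 := by
    rw [← Complex.exp_add, add_neg_cancel, Complex.exp_zero]
  simp only [map_add, map_smul, map_mul, trc'_eq, map_sub, map_ofNat, Pi.add_apply, Pi.mul_apply,
    Pi.smul_apply, Pi.sub_apply, Pi.ofNat_apply, restr_polar, restr_trX, Rat.smul_def]
  push_cast
  linear_combination -4 * h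

theorem polar_xgen_mem_homChar {n : ℕ} (i j : Fin n) :
    polar (xgen n i) (xgen n j) ∈ homChar n 1 := by
  refine mem_homChar.mpr ⟨MvPolynomial.X i * MvPolynomial.X j,
    (MvPolynomial.isHomogeneous_X _ i).mul (MvPolynomial.isHomogeneous_X _ j), ?_⟩
  funext v
  simp [restr_polar, pairing_xgen, sinhHom_X]

/-- The sum of `homChar n k` and `J ^ (k + 1)`, shown below to contain `J ^ k`. -/
def homCharSup (n k : ℕ) : Submodule ℚ (Xring n) :=
  homChar n k ⊔ (Jideal n ^ (k + 1)).restrictScalars ℚ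

theorem mem_homCharSup_of_mem_pow {n k : ℕ} {f : Xring n} (hf : f ∈ Jideal n ^ (k + 1)) :
    f ∈ homCharSup n k :=
  Submodule.mem_sup_right hf

theorem mul_mem_homCharSup_one {n : ℕ} {f g : Xring n} (hf : f ∈ Jideal n) (hg : g ∈ Jideal n) :
    f * g ∈ homCharSup n 1 :=
  mem_homCharSup_of_mem_pow (by rw [pow_two]; exact Ideal.mul_mem_mul hf hg)

theorem polar_mem_homCharSup_of_forall {n : ℕ} {y : H n}
    (h : ∀ i, polar (xgen n i) y ∈ homCharSup n 1) (x : H n) : polar x y ∈ homCharSup n 1 := by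
  have hx : x ∈ Subgroup.closure (Set.range (xgen n)) := closure_range_xgen n ▸ Subgroup.mem_top x
  induction hx using Subgroup.closure_induction with
  | mem x hx => obtain ⟨i, rfl⟩ := hx; exact h i
  | one => rw [polar_one_left]; exact zero_mem _
  | inv x _ hx => rw [polar_inv_left]; exact neg_mem hx
  | mul x z _ _ hx hz =>
    rw [polar_mul_left]
    exact add_mem (add_mem hx hz) (Submodule.smul_mem _ _ (add_mem
      (mul_mem_homCharSup_one (trc'_mem_Jideal _) (polar_mem_Jideal _ _))
      (mul_mem_homCharSup_one (trc'_mem_Jideal _) (polar_mem_Jideal _ _))))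

theorem polar_mem_homCharSup {n : ℕ} (x y : H n) : polar x y ∈ homCharSup n 1 := by
  refine polar_mem_homCharSup_of_forall (fun i => ?_) x
  rw [polar_comm]
  refine polar_mem_homCharSup_of_forall (fun j => ?_) y
  exact Submodule.mem_sup_left (polar_xgen_mem_homChar j i)

theorem trc'_mem_homCharSup {n : ℕ} (x : H n) : trc' x ∈ homCharSup n 1 := by
  have h : trc' x = (1 / 4 : ℚ) • (polar x x - trc' x * trc' x) := by
    rw [polar_self, add_sub_cancel_right, smul_smul]
    norm_num
  rw [h]
  exact Submodule.smul_mem _ _ (sub_mem (polar_mem_homCharSup x x)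
    (mul_mem_homCharSup_one (trc'_mem_Jideal x) (trc'_mem_Jideal x)))

theorem exists_sub_algebraMap_mem_Jideal {n : ℕ} (f : Xring n) :
    ∃ c : ℚ, f - algebraMap ℚ (Xring n) c ∈ Jideal n := by
  obtain ⟨f, hf⟩ := f
  induction hf using Algebra.adjoin_induction with
  | mem f hf =>
    obtain ⟨x, rfl⟩ := hf
    refine ⟨2, ?_⟩
    rw [map_ofNat]
    exact trc'_mem_Jideal x
  | algebraMap c =>
    refine ⟨c, ?_⟩
    convert zero_mem (Jideal n)
    exact sub_self (algebraMap ℚ (Xring n) c)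
  | add f g hf hg hf' hg' =>
    obtain ⟨c, hc⟩ := hf'
    obtain ⟨d, hd⟩ := hg'
    refine ⟨c + d, ?_⟩
    convert add_mem hc hd using 1
    rw [map_add]
    change (⟨f, hf⟩ + ⟨g, hg⟩ : Xring n) - _ = _
    ring
  | mul f g hf hg hf' hg' =>
    obtain ⟨c, hc⟩ := hf'
    obtain ⟨d, hd⟩ := hg'
    refine ⟨c * d, ?_⟩
    convert add_mem (Ideal.mul_mem_left _ ⟨f, hf⟩ hd)
      (Ideal.mul_mem_left _ (algebraMap ℚ (Xring n) d) hc) using 1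
    rw [map_mul]
    change (⟨f, hf⟩ * ⟨g, hg⟩ : Xring n) - _ = _
    ring

theorem Jideal_le_homCharSup (n : ℕ) : (Jideal n).restrictScalars ℚ ≤ homCharSup n 1 := by
  intro f hf
  rw [Submodule.restrictScalars_mem] at hf
  induction hf using Submodule.span_induction with
  | mem f hf =>
    obtain ⟨x, hx⟩ := hf
    rw [show f = trc' x from Subtype.ext hx]
    exact trc'_mem_homCharSup x
  | zero => exact zero_mem _
  | add f g _ _ hf hg => exact add_mem hf hg
  | smul a f hf hf' =>
    obtain ⟨c, hc⟩ := exists_sub_algebraMap_mem_Jideal a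
    have : a • f = c • f + (a - algebraMap ℚ (Xring n) c) * f := by
      rw [smul_eq_mul, Algebra.smul_def]
      ring
    rw [this]
    exact add_mem (Submodule.smul_mem _ _ hf') (mul_mem_homCharSup_one hc hf)

theorem exists_eq_single_add {n m : ℕ} {e : Fin n →₀ ℕ} (he : e.degree = m + 1) :
    ∃ i e', e = Finsupp.single i 1 + e' ∧ e'.degree = m := by
  have h0 : e ≠ 0 := by
    rintro rfl
    simp at he
  obtain ⟨i, hi⟩ := Finsupp.ne_iff.mp h0
  have h : Finsupp.single i 1 ≤ e := by
    rw [Finsupp.single_le_iff]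
    exact Nat.one_le_iff_ne_zero.mpr hi
  obtain ⟨e', rfl⟩ := exists_add_of_le h
  refine ⟨i, e', rfl, ?_⟩
  rw [map_add, Finsupp.degree_single] at he
  lia

theorem exists_restr_eq_sinhHom_monomial {n : ℕ} (k : ℕ) {e : Fin n →₀ ℕ}
    (he : e.degree = 2 * k) :
    ∃ f ∈ Jideal n ^ k, restr n f = sinhHom n (MvPolynomial.monomial e 1) := by
  induction k generalizing e with
  | zero =>
    obtain rfl : e = 0 := (Finsupp.degree_eq_zero_iff e).mp he
    exact ⟨1, by simp, by rw [map_one, ← MvPolynomial.C_apply, map_one, map_one]⟩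
  | succ k ih =>
    obtain ⟨i, e₁, rfl, he₁⟩ := exists_eq_single_add (m := 2 * k + 1) he
    obtain ⟨j, e, rfl, he₂⟩ := exists_eq_single_add (m := 2 * k) he₁
    obtain ⟨f, hf, hfe⟩ := ih he₂
    refine ⟨polar (xgen n i) (xgen n j) * f, ?_, ?_⟩
    · rw [pow_succ']
      exact Ideal.mul_mem_mul (polar_mem_Jideal _ _) hf
    · have hm : MvPolynomial.monomial (Finsupp.single i 1 + (Finsupp.single j 1 + e)) (1 : ℚ)
          = MvPolynomial.X i * MvPolynomial.X j * MvPolynomial.monomial e 1 := by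
        simp [MvPolynomial.X, MvPolynomial.monomial_mul, add_assoc]
      rw [hm, map_mul, map_mul _ _ (MvPolynomial.monomial e 1), hfe]
      congr 1
      funext v
      simp [restr_polar, pairing_xgen, sinhHom_X]

/-- Polynomials of degree `2k` in the functions `exp v_i - exp (-v_i)` come from `J ^ k`. -/
theorem exists_restr_eq_sinhHom {n : ℕ} (k : ℕ) {P : MvPolynomial (Fin n) ℚ}
    (hP : P.IsHomogeneous (2 * k)) : ∃ f ∈ Jideal n ^ k, restr n f = sinhHom n P := by
  suffices h : sinhHom n P ∈ ((Jideal n ^ k).restrictScalars ℚ).map (restr n).toLinearMap from h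
  rw [P.as_sum, map_sum]
  refine Submodule.sum_mem _ fun e he => ?_
  have hm : MvPolynomial.monomial e (P.coeff e) = P.coeff e • MvPolynomial.monomial e (1 : ℚ) := by
    rw [MvPolynomial.smul_monomial, smul_eq_mul, mul_one]
  rw [hm, map_smul]
  refine Submodule.smul_mem _ _ (exists_restr_eq_sinhHom_monomial k ?_)
  rw [Finsupp.degree_eq_weight_one]
  exact hP (MvPolynomial.mem_support_iff.mp he)

theorem homChar_le_pow (n k : ℕ) : homChar n k ≤ (Jideal n ^ k).restrictScalars ℚ := by
  intro f hf
  obtain ⟨P, hP, hPf⟩ := mem_homChar.mp hf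
  obtain ⟨g, hg, hgP⟩ := exists_restr_eq_sinhHom k hP
  rwa [restr_injective n (hPf.symm.trans hgP.symm)]

theorem pow_le_homCharSup (n k : ℕ) : (Jideal n ^ k).restrictScalars ℚ ≤ homCharSup n k := by
  induction k with
  | zero =>
    intro f _
    obtain ⟨c, hc⟩ := exists_sub_algebraMap_mem_Jideal f
    rw [← add_sub_cancel (algebraMap ℚ (Xring n) c) f]
    exact Submodule.add_mem_sup (algebraMap_mem_homChar c) (by simpa using hc)
  | succ k ih =>
    intro f hf
    rw [Submodule.restrictScalars_mem, pow_succ] at hf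
    induction hf using Submodule.mul_induction_on' with
    | mem_mul_mem f hf g hg =>
      obtain ⟨f₁, hf₁, f₂, hf₂, rfl⟩ := Submodule.mem_sup.mp (ih hf)
      obtain ⟨g₁, hg₁, g₂, hg₂, rfl⟩ := Submodule.mem_sup.mp (Jideal_le_homCharSup n hg)
      have : (f₁ + f₂) * (g₁ + g₂) = f₁ * g₁ + (f₁ * g₂ + f₂ * (g₁ + g₂)) := by ring
      rw [this]
      refine Submodule.add_mem_sup (mul_mem_homChar hf₁ hg₁) (add_mem ?_ ?_)
      · rw [Submodule.restrictScalars_mem, show k + 1 + 1 = k + (1 + 1) by lia, pow_add]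
        exact Ideal.mul_mem_mul (homChar_le_pow n k hf₁) hg₂
      · rw [Submodule.restrictScalars_mem, pow_succ]
        exact Ideal.mul_mem_mul hf₂ hg
    | add f _ g _ hf hg => exact add_mem hf hg

open Asymptotics Topology Filter in
theorem restr_isBigO_pow {n k : ℕ} {f : Xring n} (hf : f ∈ Jideal n ^ k) (v : Fin n → ℂ) :
    (fun z : ℂ => restr n f (z • v)) =O[𝓝 0] fun z => z ^ (2 * k) := by
  have h0 (f : Xring n) : (fun z : ℂ => restr n f (z • v)) =O[𝓝 0] fun _ => (1 : ℂ) := by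
    suffices h : Continuous fun z : ℂ => restr n f (z • v) from h.continuousAt.isBigO_one ℂ
    obtain ⟨f, hf⟩ := f
    change Continuous fun z : ℂ => f (diagRep (z • v))
    induction hf using Algebra.adjoin_induction with
    | mem f hf =>
      obtain ⟨x, rfl⟩ := hf
      simp only [trc_diagRep, pairing_smul]
      fun_prop
    | algebraMap c => exact continuous_const
    | add f g _ _ hf hg => exact hf.add hg
    | mul f g _ _ hf hg => exact hf.mul hg
  have h1 (f : Xring n) (hf : f ∈ Jideal n) :
      (fun z : ℂ => restr n f (z • v)) =O[𝓝 0] fun z => z ^ 2 := by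
    induction hf using Submodule.span_induction with
    | mem f hf =>
      obtain ⟨x, hx⟩ := hf
      have hd : HasDerivAt (fun z : ℂ => Complex.exp (z * (pairing x v / 2))
          - Complex.exp (-(z * (pairing x v / 2)))) (pairing x v) 0 := by
        have h := (hasDerivAt_id (0 : ℂ)).mul_const (pairing x v / 2)
        convert! h.cexp.sub h.neg.cexp using 1
        simp
      have h := (hd.isBigO_sub.pow 2)
      simp only [zero_mul, neg_zero, sub_self, sub_zero] at h
      refine h.congr_left fun z => ?_
      have he :
          Complex.exp (z * (pairing x v / 2)) * Complex.exp (-(z * (pairing x v / 2))) = 1 := by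
        rw [← Complex.exp_add, add_neg_cancel, Complex.exp_zero]
      rw [restr_apply, hx, Pi.sub_apply, trc_diagRep, pairing_smul,
        show z * pairing x v = z * (pairing x v / 2) + z * (pairing x v / 2) by ring,
        neg_add, Complex.exp_add, Complex.exp_add, Pi.ofNat_apply]
      linear_combination -2 * he
    | zero => simpa using isBigO_zero _ _
    | add f g _ _ hf hg => simpa using hf.add hg
    | smul a f _ hf => simpa using (h0 a).mul hf
  induction k generalizing f with
  | zero => simpa using h0 f
  | succ k ih =>
    rw [pow_succ] at hf
    induction hf using Submodule.mul_induction_on' with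
    | mem_mul_mem f hf g hg => simpa [mul_add, pow_add] using (ih hf).mul (h1 g hg)
    | add f _ g _ hf hg => simpa using hf.add hg

theorem aeval_smul_of_isHomogeneous {n m : ℕ} {P : MvPolynomial (Fin n) ℚ}
    (hP : P.IsHomogeneous m) (c : ℂ) (s : Fin n → ℂ) :
    MvPolynomial.aeval (c • s) P = c ^ m * MvPolynomial.aeval s P := by
  simp only [MvPolynomial.aeval_def, MvPolynomial.eval₂_eq', Finset.mul_sum]
  refine Finset.sum_congr rfl fun e he => ?_
  have hm : e.degree = m := by
    rw [Finsupp.degree_eq_weight_one]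
    exact hP (MvPolynomial.mem_support_iff.mp he)
  rw [Finsupp.degree_eq_sum] at hm
  simp only [Pi.smul_apply, smul_eq_mul, mul_pow, Finset.prod_mul_distrib,
    Finset.prod_pow_eq_pow_sum, hm]
  ring

open Asymptotics Topology Filter in
/-- The leading term of `sinhHom n P` at the origin is `P` itself, up to scaling the variables. -/
theorem eq_zero_of_sinhHom_isBigO {n m : ℕ} {P : MvPolynomial (Fin n) ℚ} (hP : P.IsHomogeneous m)
    (h : ∀ v, (fun z : ℂ => sinhHom n P (z • v)) =O[𝓝 0] fun z => z ^ (m + 2)) : P = 0 := by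
  have key (v : Fin n → ℂ) : MvPolynomial.aeval (fun i => 2 * v i) P = 0 := by
    let s (z : ℂ) : Fin n → ℂ := fun i => z⁻¹ * (Complex.exp (z * v i) - Complex.exp (-(z * v i)))
    have hs : Tendsto s (𝓝[≠] 0) (𝓝 fun i => 2 * v i) := by
      refine tendsto_pi_nhds.mpr fun i => ?_
      have hd : HasDerivAt (fun z : ℂ => Complex.exp (z * v i) - Complex.exp (-(z * v i)))
          (2 * v i) 0 := by
        have h := (hasDerivAt_id (0 : ℂ)).mul_const (v i)
        convert! h.cexp.sub h.neg.cexp using 1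
        simp
        ring
      simpa [s] using hd.tendsto_slope_zero
    have hlim : Tendsto (fun z => MvPolynomial.aeval (s z) P) (𝓝[≠] 0)
        (𝓝 (MvPolynomial.aeval (fun i => 2 * v i) P)) := by
      simp only [MvPolynomial.aeval_def, ← MvPolynomial.eval_map]
      exact ((MvPolynomial.continuous_eval _).tendsto _).comp hs
    refine tendsto_nhds_unique hlim ?_
    have hO : (fun z => MvPolynomial.aeval (s z) P) =O[𝓝[≠] 0] fun z : ℂ => z ^ 2 := by
      refine ((isBigO_refl (fun z : ℂ => (z ^ m)⁻¹) _).mul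
        ((h v).mono nhdsWithin_le_nhds)).congr' ?_ ?_
      · filter_upwards [self_mem_nhdsWithin] with z hz
        have hz' : z ≠ 0 := hz
        have : (fun i => Complex.exp ((z • v) i) - Complex.exp (-(z • v) i)) = z • s z := by
          funext i
          simp [s, hz']
        rw [sinhHom_apply, this, aeval_smul_of_isHomogeneous hP,
          inv_mul_cancel_left₀ (pow_ne_zero m hz')]
      · filter_upwards [self_mem_nhdsWithin] with z hz
        have hz' : z ≠ 0 := hz
        rw [pow_add, inv_mul_cancel_left₀ (pow_ne_zero m hz')]
    refine hO.trans_tendsto (Tendsto.mono_left ?_ nhdsWithin_le_nhds)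
    exact (continuous_pow 2).tendsto' (0 : ℂ) 0 (by simp)
  apply MvPolynomial.map_injective (algebraMap ℚ ℂ) (algebraMap ℚ ℂ).injective
  rw [map_zero]
  refine MvPolynomial.funext fun w => ?_
  have hw := key fun i => w i / 2
  simp only [mul_div_cancel₀ _ (two_ne_zero' ℂ)] at hw
  rw [MvPolynomial.eval_map, map_zero]
  exact hw

theorem eq_zero_of_sinhHom_eq_restr {n k : ℕ} {P : MvPolynomial (Fin n) ℚ}
    (hP : P.IsHomogeneous (2 * k)) {f : Xring n} (hf : f ∈ Jideal n ^ (k + 1))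
    (h : sinhHom n P = restr n f) : P = 0 :=
  eq_zero_of_sinhHom_isBigO hP fun v => by
    rw [h]
    exact restr_isBigO_pow hf v

theorem finrank_homChar (n k : ℕ) : Module.finrank ℚ (homChar n k)
    = Module.finrank ℚ (MvPolynomial.homogeneousSubmodule (Fin n) ℚ (2 * k)) := by
  let A := MvPolynomial.homogeneousSubmodule (Fin n) ℚ (2 * k)
  have hinj : Set.InjOn (sinhHom n).toLinearMap A := by
    intro P hP Q hQ hPQ
    refine sub_eq_zero.mp (eq_zero_of_sinhHom_eq_restr (k := k) (sub_mem hP hQ)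
      (zero_mem (Jideal n ^ (k + 1))) ?_)
    rw [map_sub, map_zero]
    exact sub_eq_zero.mpr hPQ
  have hA : (homChar n k).map (restr n).toLinearMap = A.map (sinhHom n).toLinearMap := by
    refine Submodule.map_comap_eq_of_le ?_
    rintro _ ⟨P, hP, rfl⟩
    obtain ⟨f, -, hf⟩ := exists_restr_eq_sinhHom k hP
    exact ⟨f, hf⟩
  calc Module.finrank ℚ (homChar n k)
      = Module.finrank ℚ ((homChar n k).map (restr n).toLinearMap) :=
        (LinearEquiv.ofBijective _ ⟨LinearMap.submoduleMap_injective (restr_injective n) _,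
          LinearMap.submoduleMap_surjective _ _⟩).finrank_eq
    _ = Module.finrank ℚ (A.map (sinhHom n).toLinearMap) := by rw [hA]
    _ = Module.finrank ℚ A :=
        (LinearEquiv.ofBijective _ ⟨LinearMap.submoduleMap_injective_of_injOn hinj,
          LinearMap.submoduleMap_surjective _ _⟩).finrank_eq.symm

theorem finrank_grJ (n k : ℕ) : Module.finrank ℚ (grJ n k) = Module.finrank ℚ (homChar n k) := by
  let K := (Jideal n ^ (k + 1)).restrictScalars ℚ
  have hgr : grJ n k = (homChar n k).map K.mkQ := by
    refine le_antisymm ?_ (Submodule.map_mono (homChar_le_pow n k))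
    refine (Submodule.map_mono (pow_le_homCharSup n k)).trans ?_
    rw [homCharSup, Submodule.map_sup, Submodule.mkQ_map_self, sup_bot_eq]
  have hinj : Set.InjOn K.mkQ (homChar n k) := by
    intro f hf g hg hfg
    rw [Submodule.mkQ_apply, Submodule.mkQ_apply, Submodule.Quotient.eq] at hfg
    obtain ⟨P, hP, hPf⟩ := mem_homChar.mp (sub_mem hf hg)
    rw [eq_zero_of_sinhHom_eq_restr hP hfg hPf, map_zero] at hPf
    exact sub_eq_zero.mp (restr_injective n (hPf.symm.trans (map_zero _).symm))
  rw [hgr]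
  exact (LinearEquiv.ofBijective _ ⟨LinearMap.submoduleMap_injective_of_injOn hinj,
    LinearMap.submoduleMap_surjective _ _⟩).finrank_eq.symm

/-- **Corollary (dimension of the graded quotients)**: for every `k ≥ 1`,
`dim_ℚ gr^k(J) = Σ_{l=0}^{k} C(n,2l)·C(n+k-l-1, k-l)`. -/
theorem finrank_graded_quotient (n k : ℕ) (hn : 1 ≤ n) (hk : 1 ≤ k) :
    Module.finrank ℚ (grJ n k)
      = ∑ l ∈ Finset.range (k + 1), Nat.choose n (2 * l) * Nat.choose (n + k - l - 1) (k - l) := by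
  obtain ⟨d, rfl⟩ := Nat.exists_eq_add_of_le' hn
  rw [finrank_grJ, finrank_homChar, finrank_homogeneousSubmodule, ← sum_choose_two_mul_mul_choose]
  refine Finset.sum_congr rfl fun l hl => ?_
  rw [Finset.mem_range] at hl
  rw [show d + 1 + k - l - 1 = d + (k - l) by lia, Nat.choose_symm_add]
end
end

section
/- The ring of Fricke characters 𝔛_ℚ(H) is an integral domain; equivalently, the ideal I = ker(π̄) is a prime ideal of the polynomial ring 𝒫. -/
set_option synthInstance.maxHeartbeats 1000000
set_option maxHeartbeats 1000000

noncomputable section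

/-- The variables of the polynomial ring `𝒫`: one variable `t_i` for each `1 ≤ i ≤ n`
and one variable `t_{ij}` for each pair `1 ≤ i < j ≤ n`. -/
abbrev Vars (n : ℕ) : Type := Fin n ⊕ {p : Fin n × Fin n // p.1 < p.2}

/-- The polynomial ring `𝒫 = ℚ[t_i, t_{ij}]`. -/
abbrev P (n : ℕ) : Type := MvPolynomial (Vars n) ℚ

/-- The ℚ-algebra homomorphism `π̄ : 𝒫 → F(R(H),ℂ)` with `π̄(t_i) = tr x_i` and
`π̄(t_{ij}) = tr (x_i x_j)`. -/
def piBar (n : ℕ) : P n →ₐ[ℚ] FR n :=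
  MvPolynomial.aeval fun v =>
    match v with
    | Sum.inl i => trc (xgen n i)
    | Sum.inr p => trc (xgen n p.1.1 * xgen n p.1.2)

/-- The ideal `I = ker π̄` of `𝒫`. -/
def Iideal (n : ℕ) : Ideal (P n) := RingHom.ker (piBar n).toRingHom

/-- The diagonal representation `x ↦ diag (χ x, (χ x)⁻¹)` attached to a character `χ`. -/
def diagonalRep {n : ℕ} (χ : H n →* ℂˣ) : H n →* SL2 where
  toFun x := ⟨!![(χ x : ℂ), 0; 0, ((χ x)⁻¹ : ℂˣ)], by simp [Matrix.det_fin_two]⟩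
  map_one' := by
    ext i j
    fin_cases i <;> fin_cases j <;> simp
  map_mul' x y := by
    refine Subtype.ext ?_
    change !![(χ (x * y) : ℂ), 0; 0, ((χ (x * y))⁻¹ : ℂˣ)] =
      !![(χ x : ℂ), 0; 0, ((χ x)⁻¹ : ℂˣ)] * !![(χ y : ℂ), 0; 0, ((χ y)⁻¹ : ℂˣ)]
    simp [mul_comm]

/-- The character `x ↦ exp (∑ i, x i * z i)`. -/
def expChar {n : ℕ} (z : Fin n → ℂ) : H n →* ℂˣ :=
  MonoidHom.toHomUnits
    { toFun := fun x => Complex.exp (∑ i, (x.toAdd i : ℂ) * z i)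
      map_one' := by simp
      map_mul' := fun x y => by
        simp [add_mul, Finset.sum_add_distrib, Complex.exp_add] }

lemma expChar_apply {n : ℕ} (z : Fin n → ℂ) (x : H n) :
    (expChar z x : ℂ) = Complex.exp (∑ i, (x.toAdd i : ℂ) * z i) := rfl

lemma trc_diagonalRep {n : ℕ} (χ : H n →* ℂˣ) (x : H n) :
    trc x (diagonalRep χ) = χ x + ((χ x)⁻¹ : ℂˣ) := by
  change Matrix.trace !![(χ x : ℂ), 0; 0, ((χ x)⁻¹ : ℂˣ)] = _
  simp [Matrix.trace_fin_two]

lemma trc_diagonalRep_expChar {n : ℕ} (z : Fin n → ℂ) (x : H n) :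
    trc x (diagonalRep (expChar z)) =
      Complex.exp (∑ i, (x.toAdd i : ℂ) * z i) + Complex.exp (-∑ i, (x.toAdd i : ℂ) * z i) := by
  rw [trc_diagonalRep, Units.val_inv_eq_inv_val, expChar_apply, Complex.exp_neg]

lemma hom_ext_xgen {n : ℕ} {M : Type*} [CommGroup M] {f g : H n →* M}
    (h : ∀ i, f (xgen n i) = g (xgen n i)) : f = g := by
  apply MonoidHom.toAdditiveRight.injective
  refine AddMonoidHom.functions_ext' (N := Additive M) _ _ fun i => ?_
  ext
  exact h i

lemma exists_eq_expChar {n : ℕ} (χ : H n →* ℂˣ) : ∃ z, χ = expChar z := by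
  refine ⟨fun i => Complex.log (χ (xgen n i)), hom_ext_xgen fun i => Units.ext ?_⟩
  rw [expChar_apply]
  simp [xgen, Pi.single_apply, Complex.exp_log]

/-- A nontrivial commutative algebra of finite dimension over an algebraically closed field has a
character. -/
lemma exists_algHom_of_finite (k A : Type*) [Field k] [IsAlgClosed k] [CommRing A] [Nontrivial A]
    [Algebra k A] [Module.Finite k A] : Nonempty (A →ₐ[k] k) := by
  obtain ⟨m, hm⟩ := Ideal.exists_maximal A
  let := Ideal.Quotient.field m
  exact ⟨(IsAlgClosed.lift : A ⧸ m →ₐ[k] k).comp (Ideal.Quotient.mkₐ k m)⟩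

open scoped IsMulCommutative in
/-- Every representation of `H` has the same traces as a diagonal one. -/
lemma exists_trc_eq_trc_diagonalRep {n : ℕ} (ρ : H n →* SL2) :
    ∃ χ : H n →* ℂˣ, ∀ x, trc x ρ = trc x (diagonalRep χ) := by
  let s : Set (Matrix (Fin 2) (Fin 2) ℂ) := Set.range fun x => (ρ x : Matrix (Fin 2) (Fin 2) ℂ)
  have hs : ∀ a ∈ s, ∀ b ∈ s, a * b = b * a := by
    rintro _ ⟨x, rfl⟩ _ ⟨y, rfl⟩
    dsimp only
    rw [← Matrix.SpecialLinearGroup.coe_mul, ← Matrix.SpecialLinearGroup.coe_mul, ← map_mul,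
      ← map_mul, mul_comm]
  have := Algebra.isMulCommutative_adjoin ℂ hs
  obtain ⟨φ⟩ := exists_algHom_of_finite ℂ (Algebra.adjoin ℂ s)
  let ψ : H n →* Algebra.adjoin ℂ s :=
    { toFun := fun x => ⟨ρ x, Algebra.subset_adjoin ⟨x, rfl⟩⟩
      map_one' := by ext1; simp
      map_mul' := fun x y => by ext1; simp }
  refine ⟨MonoidHom.toHomUnits ((φ : Algebra.adjoin ℂ s →* ℂ).comp ψ), fun x => ?_⟩
  rw [trc_diagonalRep, Units.val_inv_eq_inv_val]
  have hψ : ψ x * ψ x + 1 = trc x ρ • ψ x := by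
    ext1
    have hdet := (ρ x).det_coe
    rw [Matrix.det_fin_two] at hdet
    ext i j
    fin_cases i <;> fin_cases j <;>
      simp [ψ, trc, Matrix.trace_fin_two, Matrix.mul_apply, Fin.sum_univ_two] <;>
      first
      | ring1
      | linear_combination -hdet
  have hφ := congrArg φ hψ
  rw [map_add, map_mul, map_one, map_smul, smul_eq_mul] at hφ
  change _ = φ (ψ x) + (φ (ψ x))⁻¹
  have h0 : φ (ψ x) ≠ 0 := fun h => by simp [h] at hφ
  field_simp
  linear_combination -hφ

lemma exists_apply_eq_apply_diagonalRep_expChar {n : ℕ} (ρ : H n →* SL2) :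
    ∃ z : Fin n → ℂ, ∀ f ∈ Xring n, f ρ = f (diagonalRep (expChar z)) := by
  obtain ⟨χ, hχ⟩ := exists_trc_eq_trc_diagonalRep ρ
  obtain ⟨z, rfl⟩ := exists_eq_expChar χ
  refine ⟨z, fun f hf => ?_⟩
  induction hf using Algebra.adjoin_induction with
  | mem f hf =>
    obtain ⟨x, rfl⟩ := hf
    exact hχ x
  | algebraMap r => rfl
  | add f g _ _ hf hg => simp only [Pi.add_apply, hf, hg]
  | mul f g _ _ hf hg => simp only [Pi.mul_apply, hf, hg]

lemma differentiable_apply_diagonalRep_expChar {n : ℕ} (a b : Fin n → ℂ) {f : FR n}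
    (hf : f ∈ Xring n) : Differentiable ℂ fun t : ℂ => f (diagonalRep (expChar (a + t • b))) := by
  induction hf using Algebra.adjoin_induction with
  | mem f hf =>
    obtain ⟨x, rfl⟩ := hf
    simp only [trc_diagonalRep_expChar, Pi.add_apply, Pi.smul_apply, smul_eq_mul]
    fun_prop
  | algebraMap r => exact differentiable_const _
  | add f g _ _ hf hg => exact hf.add hg
  | mul f g _ _ hf hg => exact hf.mul hg

lemma eq_zero_or_eq_zero_of_mem_Xring {n : ℕ} {f g : FR n} (hf : f ∈ Xring n) (hg : g ∈ Xring n)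
    (hfg : f * g = 0) : f = 0 ∨ g = 0 := by
  by_contra! h
  obtain ⟨ρ, hρ⟩ := Function.ne_iff.mp h.1
  obtain ⟨σ, hσ⟩ := Function.ne_iff.mp h.2
  obtain ⟨a, ha⟩ := exists_apply_eq_apply_diagonalRep_expChar ρ
  obtain ⟨b, hb⟩ := exists_apply_eq_apply_diagonalRep_expChar σ
  rw [ha f hf] at hρ
  rw [hb g hg] at hσ
  rcases AnalyticOnNhd.eq_zero_or_eq_zero_of_mul_eq_zero
    (Complex.analyticOnNhd_univ_iff_differentiable.mpr
      (differentiable_apply_diagonalRep_expChar a (b - a) hf))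
    (Complex.analyticOnNhd_univ_iff_differentiable.mpr
      (differentiable_apply_diagonalRep_expChar a (b - a) hg))
    (fun t _ => congrFun hfg _) isPreconnected_univ with h0 | h0
  · exact hρ (by simpa using h0 0 trivial)
  · exact hσ (by simpa using h0 1 trivial)

lemma piBar_mem_Xring {n : ℕ} (p : P n) : piBar n p ∈ Xring n := by
  have hp : piBar n p ∈ (piBar n).range := ⟨p, rfl⟩
  rw [piBar, ← Algebra.adjoin_range_eq_range_aeval] at hp
  refine Algebra.adjoin_mono ?_ hp
  rintro _ ⟨i | q, rfl⟩
  · exact ⟨_, rfl⟩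
  · exact ⟨_, rfl⟩

/-- **Theorem (Theorem 4.2 / Theorem 1.4)**: the ring `𝔛_ℚ(H)` of Fricke characters of the free
abelian group `H` of rank `n` is an integral domain; equivalently, the ideal `I = ker π̄` is a
prime ideal of the polynomial ring `𝒫`. -/
theorem Xring_isDomain_and_Iideal_isPrime (n : ℕ) (hn : 1 ≤ n) :
    IsDomain (Xring n) ∧ (Iideal n).IsPrime := by
  constructor
  · have : NoZeroDivisors (Xring n) :=
      ⟨fun {f g} h => by
        simpa using eq_zero_or_eq_zero_of_mem_Xring f.2 g.2 (congrArg Subtype.val h)⟩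
    exact NoZeroDivisors.to_isDomain _
  · refine Ideal.isPrime_iff.mpr ⟨RingHom.ker_ne_top _, fun {p q} h => ?_⟩
    refine eq_zero_or_eq_zero_of_mem_Xring (piBar_mem_Xring p) (piBar_mem_Xring q) ?_
    rw [← map_mul]
    exact h
end
end

section
/- Let A, B, C, D ∈ SL(2,ℂ) be pairwise commuting matrices and write τ(M) := trace(M) − 2. Then τ(AC)·τ(BD) = τ(AD)·τ(BC) + (τ(A)τ(C) + τ(B)τ(D) − τ(B)τ(C) − τ(A)τ(D)) − (τ(A)τ(BC) + τ(B)τ(AD) + τ(C)τ(AD) + τ(D)τ(BC) − τ(B)τ(AC) − τ(A)τ(BD) − τ(C)τ(BD) − τ(D)τ(AC)) − (1/2)·(τ(B)τ(C)τ(AD) + τ(A)τ(D)τ(BC) − τ(A)τ(C)τ(BD) − τ(B)τ(D)τ(AC)). -/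
noncomputable section

/-- `τ(M) = trace(M) - 2`. -/
def tau (M : SL2) : ℂ := Matrix.trace (M : Matrix (Fin 2) (Fin 2) ℂ) - 2

/-- **Lemma 3.2 (Lemma `colon`), evaluated form**: the fundamental quadratic relation among
shifted traces `τ(M) = tr(M) - 2` of pairwise commuting matrices `A, B, C, D ∈ SL(2,ℂ)`. -/
theorem tau_mul_relation (A B C D : SL2)
    (hAB : A * B = B * A) (hAC : A * C = C * A) (hAD : A * D = D * A)
    (hBC : B * C = C * B) (hBD : B * D = D * B) (hCD : C * D = D * C) :
    tau (A * C) * tau (B * D)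
      = tau (A * D) * tau (B * C)
        + (tau A * tau C + tau B * tau D - tau B * tau C - tau A * tau D)
        - (tau A * tau (B * C) + tau B * tau (A * D) + tau C * tau (A * D) + tau D * tau (B * C)
            - tau B * tau (A * C) - tau A * tau (B * D) - tau C * tau (B * D)
            - tau D * tau (A * C))
        - (1 / 2) * (tau B * tau C * tau (A * D) + tau A * tau D * tau (B * C)
            - tau A * tau C * tau (B * D) - tau B * tau D * tau (A * C)) := by
  have h00 := congrArg (fun M : SL2 => M 0 0) hAB
  have h01 := congrArg (fun M : SL2 => M 0 1) hAB
  have h10 := congrArg (fun M : SL2 => M 1 0) hAB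
  simp only [Matrix.SpecialLinearGroup.coe_mul, Matrix.mul_apply, Fin.sum_univ_two] at h00 h01 h10
  simp only [tau, Matrix.SpecialLinearGroup.coe_mul, Matrix.trace_fin_two, Matrix.mul_apply,
    Fin.sum_univ_two]
  linear_combination
    (C 1 0 * D 0 1 - D 1 0 * C 0 1) * h00
      + ((C 0 0 - C 1 1) * D 1 0 - (D 0 0 - D 1 1) * C 1 0) / 2 * h01
      - ((C 0 0 - C 1 1) * D 0 1 - (D 0 0 - D 1 1) * C 0 1) / 2 * h10
end
end

section
/- Let A, B ∈ SL(2,ℂ) be commuting matrices and write τ(M) := trace(M) − 2. Then τ(AB)² = −τ(A)² − τ(B)² + 2·(τ(A)τ(B) + τ(A)τ(AB) + τ(B)τ(AB)) + τ(A)τ(B)τ(AB). -/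
noncomputable section

/-- For `2 × 2` matrices, `-det (AB - BA)` is the Fricke polynomial in the traces of `A`, `B`, `AB`
and the determinants of `A`, `B`. -/
theorem Matrix.neg_det_commutator_fin_two {R : Type*} [CommRing R] 
    (A B : Matrix (Fin 2) (Fin 2) R) :
    -(A * B - B * A).det
      = A.trace ^ 2 * B.det + B.trace ^ 2 * A.det + (A * B).trace ^ 2
        - A.trace * B.trace * (A * B).trace - 4 * A.det * B.det := by
  simp only [Matrix.det_fin_two, Matrix.trace_fin_two, Matrix.mul_apply, Fin.sum_univ_two,
    Matrix.sub_apply]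
  ring

/-- **Corollary 3.4 (Corollary `sipre`), evaluated form**: for commuting `A, B ∈ SL(2,ℂ)`,
`τ(AB)² = -τ(A)² - τ(B)² + 2(τ(A)τ(B) + τ(A)τ(AB) + τ(B)τ(AB)) + τ(A)τ(B)τ(AB)`. -/
theorem tau_mul_sq (A B : SL2) (hAB : A * B = B * A) :
    tau (A * B) ^ 2
      = -tau A ^ 2 - tau B ^ 2
        + 2 * (tau A * tau B + tau A * tau (A * B) + tau B * tau (A * B))
        + tau A * tau B * tau (A * B) := by
  have hcomm : (A : Matrix (Fin 2) (Fin 2) ℂ) * B - B * A = 0 := by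
    rw [sub_eq_zero, ← Matrix.SpecialLinearGroup.coe_mul, hAB, Matrix.SpecialLinearGroup.coe_mul]
  have key := Matrix.neg_det_commutator_fin_two (A : Matrix (Fin 2) (Fin 2) ℂ) B
  rw [hcomm, Matrix.det_zero, A.det_coe, B.det_coe] at key
  simp only [tau, Matrix.SpecialLinearGroup.coe_mul]
  linear_combination -key
end
end

section
/- Every element of 𝒫 is congruent modulo I to a ℚ-linear combination of monomials of the form t'_{p_1q_1}⋯t'_{p_lq_l}·t'_{i_{l+1}}⋯t'_{i_k}, where k ≥ 0, 0 ≤ l ≤ k, 1 ≤ p_1 < q_1 < p_2 < q_2 < ⋯ < p_l < q_l ≤ n, and 1 ≤ i_{l+1} ≤ ⋯ ≤ i_k ≤ n. Equivalently, the cosets modulo I of these monomials span the ℚ-vector space 𝒫/I. -/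
set_option synthInstance.maxHeartbeats 1000000
set_option maxHeartbeats 1000000

noncomputable section

/-- `t'_i = t_i - 2`. -/
def tp (n : ℕ) (i : Fin n) : P n := MvPolynomial.X (Sum.inl i) - 2

/-- `t'_{ij} = t_{ij} - 2` for arbitrary indices `i`, `j`, where `t'_{ij}` for `i > j` is read as
`t'_{ji}`, and `t'_{ii}` is read as `(t'_i)² + 4 t'_i`. -/
def tpp (n : ℕ) (i j : Fin n) : P n :=
  if h : i < j then MvPolynomial.X (Sum.inr ⟨(i, j), h⟩) - 2
  else if h' : j < i then MvPolynomial.X (Sum.inr ⟨(j, i), h'⟩) - 2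
  else tp n i ^ 2 + 4 * tp n i

/-- Index data for a normal-form monomial: an integer `k ≥ 0`, an integer `0 ≤ l ≤ k`, indices
`1 ≤ p_1 < q_1 < p_2 < q_2 < ⋯ < p_l < q_l ≤ n` and `1 ≤ i_{l+1} ≤ ⋯ ≤ i_k ≤ n`. -/
structure BIdx (n k : ℕ) where
  l : ℕ
  hlk : l ≤ k
  pq : Fin l → Fin n × Fin n
  hpq : ∀ j, (pq j).1 < (pq j).2
  hchain : ∀ j j' : Fin l, j < j' → (pq j).2 < (pq j').1
  idx : Fin (k - l) → Fin n
  hidx : Monotone idx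

/-- The monomial `t'_{p_1q_1}⋯t'_{p_lq_l}·t'_{i_{l+1}}⋯t'_{i_k} ∈ 𝒫`. -/
def pelt {n k : ℕ} (d : BIdx n k) : P n :=
  (∏ j : Fin d.l, tpp n (d.pq j).1 (d.pq j).2) * ∏ j : Fin (k - d.l), tp n (d.idx j)

section NormalForm

variable {ι R : Type*} [LinearOrder ι] [CommRing R]

/-- Lists of pairs `(p₁, q₁), …, (p_l, q_l)` with `p₁ < q₁ < p₂ < q₂ < ⋯ < p_l < q_l`. -/
def IsPairChain (l : List (ι × ι)) : Prop :=
  (∀ p ∈ l, p.1 < p.2) ∧ l.Pairwise fun p q => p.2 < q.1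

theorem IsPairChain.sublist {l l' : List (ι × ι)} (h : IsPairChain l') (hl : l.Sublist l') :
    IsPairChain l :=
  ⟨fun p hp => h.1 p (hl.subset hp), h.2.sublist hl⟩

theorem exists_isPairChain_prod_eq (D : ι → R) :
    ∀ L : List ι, L.Pairwise (· < ·) → Even L.length → ∃ l : List (ι × ι),
      IsPairChain l ∧ (∀ p ∈ l, p.1 ∈ L) ∧
        (L.map D).prod = (l.map fun p => D p.1 * D p.2).prod
  | [], _, _ => ⟨[], ⟨by simp, by simp⟩, by simp, by simp⟩
  | [a], _, h => by simp at h
  | a :: b :: L, hL, h => by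
    simp only [List.pairwise_cons, List.mem_cons, forall_eq_or_imp] at hL
    obtain ⟨l, hl, hmem, hprod⟩ := exists_isPairChain_prod_eq D L hL.2.2
      (by simpa [Nat.even_add_one] using h)
    refine ⟨(a, b) :: l, ⟨?_, ?_⟩, ?_, ?_⟩
    · rintro p (_ | ⟨_, hp⟩)
      exacts [hL.1.1, hl.1 p hp]
    · exact List.pairwise_cons.2 ⟨fun p hp => hL.2.1 _ (hmem p hp), hl.2⟩
    · rintro p (_ | ⟨_, hp⟩)
      · simp
      · simp [hmem p hp]
    · simp [hprod, mul_assoc]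

variable [Algebra ℚ R]

/-- The rational span of the products of `u p.1 p.2 - 2` over a pair chain with a monomial
in the elements `t i - 2`. -/
def chainSpan (t : ι → R) (u : ι → ι → R) : Submodule ℚ R :=
  Submodule.span ℚ {x | ∃ (l : List (ι × ι)) (m : Multiset ι), IsPairChain l ∧
    x = (l.map fun p => u p.1 p.2 - 2).prod * (m.map fun i => t i - 2).prod}

theorem mul_mem_chainSpan (t : ι → R) (u : ι → ι → R) (i : ι) {x : R}
    (hx : x ∈ chainSpan t u) : t i * x ∈ chainSpan t u := by
  induction hx using Submodule.span_induction with
  | mem x hx =>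
    obtain ⟨l, m, hl, rfl⟩ := hx
    have h₁ : (l.map fun p => u p.1 p.2 - 2).prod * (m.map fun i => t i - 2).prod
        ∈ chainSpan t u := Submodule.subset_span ⟨l, m, hl, rfl⟩
    have h₂ : (l.map fun p => u p.1 p.2 - 2).prod * ((i ::ₘ m).map fun i => t i - 2).prod
        ∈ chainSpan t u := Submodule.subset_span ⟨l, i ::ₘ m, hl, rfl⟩
    convert add_mem h₂ (add_mem h₁ h₁) using 1
    rw [Multiset.map_cons, Multiset.prod_cons]
    ring
  | zero => simp
  | add x y _ _ hx hy => rw [mul_add]; exact add_mem hx hy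
  | smul a x _ hx => rw [mul_smul_comm]; exact Submodule.smul_mem _ _ hx

theorem mul_prod_mem_chainSpan (t : ι → R) (u : ι → ι → R) (D : ι → R)
    (hD : ∀ i j, i < j → D i * D j = 2 * u i j - t i * t j) (l : List (ι × ι)) :
    ∀ l₁, IsPairChain (l₁ ++ l) →
      (l₁.map fun p => u p.1 p.2 - 2).prod * (l.map fun p => D p.1 * D p.2).prod
        ∈ chainSpan t u := by
  induction l with
  | nil => exact fun l₁ h => Submodule.subset_span ⟨l₁, 0, by simpa using h, by simp⟩
  | cons p l ih =>
    intro l₁ h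
    have h₁ := ih (l₁ ++ [p]) (by simpa using h)
    have h₂ := ih l₁ (h.sublist (by simp))
    have h₃ := mul_mem_chainSpan t u p.1 (mul_mem_chainSpan t u p.2 h₂)
    have h₄ := add_mem h₂ h₂
    convert sub_mem (add_mem (add_mem h₁ h₁) (add_mem h₄ h₄)) h₃ using 1
    rw [List.map_append, List.prod_append, List.map_cons, List.prod_cons,
      hD _ _ (h.1 p (by simp))]
    simp only [List.map_cons, List.map_nil, List.prod_cons, List.prod_nil]
    ring

theorem prod_mem_chainSpan (t : ι → R) (u : ι → ι → R) (D : ι → R)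
    (hD : ∀ i j, i < j → D i * D j = 2 * u i j - t i * t j)
    (hD' : ∀ i, D i * D i = t i * t i - 4) (m : Multiset ι) (hm : Even m.card) :
    (m.map D).prod ∈ chainSpan t u := by
  induction hc : m.card using Nat.strong_induction_on generalizing m with
  | _ c ih =>
  subst hc
  by_cases hn : m.Nodup
  · obtain ⟨l, hl, -, hprod⟩ := exists_isPairChain_prod_eq D (m.sort (· ≤ ·))
      ((List.Pairwise.and (Multiset.pairwise_sort m (· ≤ ·))
        (by simpa [← Multiset.coe_nodup] using hn : (m.sort (· ≤ ·)).Nodup)).imp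
          fun h => lt_of_le_of_ne h.1 h.2)
      (by simpa using hm)
    have h := mul_prod_mem_chainSpan t u D hD l [] hl
    rw [← hprod] at h
    have hms : (m.map D).prod = ((m.sort (· ≤ ·)).map D).prod := by
      conv_lhs => rw [← Multiset.sort_eq m (· ≤ ·)]
      rw [Multiset.map_coe, Multiset.prod_coe]
    simpa [hms] using h
  · obtain ⟨i, hi⟩ : ∃ i, i ::ₘ i ::ₘ 0 ≤ m := by
      simpa [Multiset.nodup_iff_le] using hn
    obtain ⟨m', rfl⟩ := Multiset.le_iff_exists_add.1 hi
    have h := ih m'.card (by simp) m' (by simpa [Nat.even_add] using hm) rfl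
    have h₁ := mul_mem_chainSpan t u i (mul_mem_chainSpan t u i h)
    have h₂ := add_mem h h
    convert sub_mem h₁ (add_mem h₂ h₂) using 1
    simp only [Multiset.map_add, Multiset.prod_add, Multiset.map_cons, Multiset.prod_cons,
      Multiset.map_zero, Multiset.prod_zero, mul_one, hD']
    ring

end NormalForm

theorem exists_mul_eq_of_rank_one {ι K : Type*} [Field K] [IsAlgClosed K] (e : ι → ι → K)
    (h : ∀ i j k l, e i j * e k l = e i k * e j l) :
    ∃ d : ι → K, ∀ i j, d i * d j = e i j := by
  by_cases h0 : ∀ i, e i i = 0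
  · refine ⟨0, fun i j => ?_⟩
    have hij : e i j = 0 := by simpa [h0] using h i i j j
    simp [hij]
  · push Not at h0
    obtain ⟨k, hk⟩ := h0
    obtain ⟨r, hr⟩ := IsAlgClosed.exists_pow_nat_eq (e k k) (n := 2) (by norm_num)
    have hr0 : r ≠ 0 := by
      rintro rfl
      exact hk (by simpa using hr.symm)
    refine ⟨fun i => e i k / r, fun i j => ?_⟩
    rw [div_mul_div_comm, ← sq, hr, div_eq_iff hk]
    exact (h i j k k).symm

theorem trace_rank_one_of_commute (A B C D : Matrix (Fin 2) (Fin 2) ℂ) (hBC : B * C = C * B) :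
    (2 * (A * B).trace - A.trace * B.trace) * (2 * (C * D).trace - C.trace * D.trace) =
      (2 * (A * C).trace - A.trace * C.trace) * (2 * (B * D).trace - B.trace * D.trace) := by
  have h₀ := congr_fun₂ hBC 0 0
  have h₁ := congr_fun₂ hBC 0 1
  have h₂ := congr_fun₂ hBC 1 0
  simp only [Matrix.mul_apply, Fin.sum_univ_two] at h₀ h₁ h₂
  simp only [Matrix.trace_fin_two, Matrix.mul_apply, Fin.sum_univ_two]
  grind

theorem trace_sq_of_det_one (A : SL2) :
    2 * ((A : Matrix (Fin 2) (Fin 2) ℂ) * A).trace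
        - (A : Matrix (Fin 2) (Fin 2) ℂ).trace * (A : Matrix (Fin 2) (Fin 2) ℂ).trace =
      (A : Matrix (Fin 2) (Fin 2) ℂ).trace * (A : Matrix (Fin 2) (Fin 2) ℂ).trace - 4 := by
  have h := A.det_coe
  rw [Matrix.det_fin_two] at h
  simp only [Matrix.trace_fin_two, Matrix.mul_apply, Fin.sum_univ_two]
  linear_combination (-4) * h

theorem exists_discriminant_root (n : ℕ) : ∃ D : Fin n → FR n, ∀ i j,
    D i * D j = 2 * trc (xgen n i * xgen n j) - trc (xgen n i) * trc (xgen n j) := by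
  have h (ρ : H n →* SL2) : ∃ d : Fin n → ℂ, ∀ i j, d i * d j =
      2 * trc (xgen n i * xgen n j) ρ - trc (xgen n i) ρ * trc (xgen n j) ρ := by
    refine exists_mul_eq_of_rank_one _ fun i j k l => ?_
    simp only [trc, map_mul, Matrix.SpecialLinearGroup.coe_mul]
    refine trace_rank_one_of_commute _ _ _ _ ?_
    rw [← Matrix.SpecialLinearGroup.coe_mul, ← Matrix.SpecialLinearGroup.coe_mul, ← map_mul,
      ← map_mul, mul_comm]
  choose d hd using h
  exact ⟨fun i ρ => d ρ i, fun i j => funext fun ρ => hd ρ i j⟩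

theorem exists_pelt_eq {n : ℕ} (l : List (Fin n × Fin n)) (m : Multiset (Fin n))
    (hl : IsPairChain l) : ∃ d : Σ k : ℕ, BIdx n k,
      pelt d.2 = (l.map fun p => tpp n p.1 p.2).prod * (m.map (tp n)).prod := by
  have hlen : (m.sort (· ≤ ·)).length = l.length + m.card - l.length := by simp
  refine ⟨⟨l.length + m.card,
    { l := l.length
      hlk := Nat.le_add_right _ _
      pq := l.get
      hpq := fun j => hl.1 _ (l.get_mem j)
      hchain := fun j j' h => List.pairwise_iff_get.1 hl.2 j j' h
      idx := fun j => (m.sort (· ≤ ·)).get (j.cast hlen.symm)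
      hidx := fun a b h =>
        (Multiset.pairwise_sort m (· ≤ ·)).rel_get_of_le (by simpa using h) }⟩, ?_⟩
  have h₁ : (l.map fun p => tpp n p.1 p.2).prod =
      ∏ j : Fin l.length, tpp n (l.get j).1 (l.get j).2 := by
    conv_lhs => rw [← List.ofFn_get l, List.map_ofFn, List.prod_ofFn]
    rfl
  have h₂ : (m.map (tp n)).prod =
      ∏ j : Fin (l.length + m.card - l.length),
        tp n ((m.sort (· ≤ ·)).get (j.cast hlen.symm)) := by
    rw [← (finCongr hlen).prod_comp]
    conv_lhs => rw [← Multiset.sort_eq m (· ≤ ·)]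
    rw [Multiset.map_coe, Multiset.prod_coe]
    conv_lhs => rw [← List.ofFn_get (m.sort (· ≤ ·)), List.map_ofFn, List.prod_ofFn]
    rfl
  rw [h₁, h₂]
  rfl

theorem chainSpan_le_map_piBar (n : ℕ) :
    chainSpan (fun i => trc (xgen n i)) (fun i j => trc (xgen n i * xgen n j)) ≤
      (Submodule.span ℚ (Set.range fun d : Σ k : ℕ, BIdx n k => pelt d.2)).map
        (piBar n).toLinearMap := by
  rw [chainSpan, Submodule.span_le]
  rintro _ ⟨l, m, hl, rfl⟩
  obtain ⟨d, hd⟩ := exists_pelt_eq l m hl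
  refine ⟨pelt d.2, Submodule.subset_span ⟨d, rfl⟩, ?_⟩
  rw [hd, AlgHom.toLinearMap_apply, map_mul, map_list_prod, map_multiset_prod, List.map_map,
    Multiset.map_map]
  congr 2
  · refine List.map_congr_left fun p hp => ?_
    simp [tpp, hl.1 p hp, piBar]
  · refine Multiset.map_congr rfl fun i _ => ?_
    simp [tp, piBar]

theorem piBar_mul_prod_mem_chainSpan (n : ℕ) (D : Fin n → FR n)
    (hD : ∀ i j, D i * D j =
      2 * trc (xgen n i * xgen n j) - trc (xgen n i) * trc (xgen n j)) (f : P n) :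
    ∀ m : Multiset (Fin n), Even m.card → piBar n f * (m.map D).prod ∈
      chainSpan (fun i => trc (xgen n i)) (fun i j => trc (xgen n i * xgen n j)) := by
  induction f using MvPolynomial.induction_on with
  | C a =>
    intro m hm
    rw [← MvPolynomial.algebraMap_eq, AlgHom.commutes, ← Algebra.smul_def]
    refine Submodule.smul_mem _ _ (prod_mem_chainSpan _ _ D (fun i j _ => hD i j) ?_ m hm)
    intro i
    rw [hD]
    funext ρ
    simpa [trc] using trace_sq_of_det_one (ρ (xgen n i))
  | add p q hp hq =>
    intro m hm
    rw [map_add, add_mul]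
    exact add_mem (hp m hm) (hq m hm)
  | mul_X p v ih =>
    intro m hm
    rw [map_mul]
    rcases v with i | ⟨⟨i, j⟩, hij⟩
    · convert mul_mem_chainSpan (fun i => trc (xgen n i)) _ i (ih m hm) using 1
      simp only [piBar, MvPolynomial.aeval_X]
      ring
    · have h₁ := ih (i ::ₘ j ::ₘ m) (by simpa [Nat.even_add_one] using hm)
      have h₂ := mul_mem_chainSpan (fun i => trc (xgen n i)) _ i
        (mul_mem_chainSpan (fun i => trc (xgen n i)) _ j (ih m hm))
      convert Submodule.smul_mem _ (1 / 2 : ℚ) (add_mem h₁ h₂) using 1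
      have hX : piBar n (MvPolynomial.X (Sum.inr ⟨(i, j), hij⟩)) =
          trc (xgen n i * xgen n j) := by
        simp [piBar]
      rw [hX, Multiset.map_cons, Multiset.map_cons, Multiset.prod_cons, Multiset.prod_cons,
        ← mul_assoc (D i), hD, eq_comm, one_div, inv_smul_eq_iff₀ two_ne_zero, ofNat_smul_eq_nsmul,
        two_nsmul]
      ring

/-- **Proposition 3.1 (Proposition `popli`)**: every element of `𝒫` is congruent modulo `I` to a
ℚ-linear combination of the monomials `t'_{p_1q_1}⋯t'_{p_lq_l}·t'_{i_{l+1}}⋯t'_{i_k}`; that is,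
the cosets of these monomials span the ℚ-vector space `𝒫/I`. -/
theorem span_pelt_quotient (n : ℕ) (hn : 1 ≤ n) :
    Submodule.span ℚ (Set.range fun d : Σ k : ℕ, BIdx n k =>
        Ideal.Quotient.mk (Iideal n) (pelt d.2)) = ⊤ := by
  obtain ⟨D, hD⟩ := exists_discriminant_root n
  refine eq_top_iff.2 fun x _ => ?_
  obtain ⟨f, rfl⟩ := Ideal.Quotient.mk_surjective x
  obtain ⟨g, hg, hgf⟩ := chainSpan_le_map_piBar n
    (piBar_mul_prod_mem_chainSpan n D hD f 0 (by simp))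
  have hfg : Ideal.Quotient.mk (Iideal n) g = Ideal.Quotient.mk (Iideal n) f := by
    rw [Ideal.Quotient.eq, Iideal, RingHom.mem_ker]
    simpa [sub_eq_zero] using hgf
  rw [← hfg]
  have h := Submodule.mem_map_of_mem (f := (Ideal.Quotient.mkₐ ℚ (Iideal n)).toLinearMap) hg
  rw [Submodule.map_span, ← Set.range_comp] at h
  exact h
end
end

section
/- For every n ≥ 2 and every k ≥ 1, the ℚ-dimension of gr^k(J_{F_n}) := J_{F_n}^k/J_{F_n}^{k+1} is at least Σ_{l=0}^{k} C(n, 2l)·C(n + k − l − 1, k − l), where C(a,b) denotes the binomial coefficient. -/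
set_option synthInstance.maxHeartbeats 1000000
set_option maxHeartbeats 1000000

noncomputable section

/-- The algebra of complex-valued functions on the representation space `R(F_n)` of the free
group `F_n` on `n` generators. -/
abbrev FRf (n : ℕ) : Type := (FreeGroup (Fin n) →* SL2) → ℂ

/-- The Fricke character `tr x` for `x ∈ F_n`. -/
def trcF {n : ℕ} (x : FreeGroup (Fin n)) : FRf n :=
  fun ρ => Matrix.trace ((ρ x : Matrix (Fin 2) (Fin 2) ℂ))

/-- The ring of Fricke characters `𝔛_ℚ(F_n)`. -/
def XringF (n : ℕ) : Subalgebra ℚ (FRf n) :=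
  Algebra.adjoin ℚ {f : FRf n | ∃ x : FreeGroup (Fin n), f = trcF x}

/-- The ideal `J_{F_n}` of `𝔛_ℚ(F_n)` generated by the elements
`tr'(x_{i_1}⋯x_{i_l}) = tr(x_{i_1}⋯x_{i_l}) - 2` for `1 ≤ l ≤ 3` and
`1 ≤ i_1 < ⋯ < i_l ≤ n`. -/
def JF (n : ℕ) : Ideal (XringF n) :=
  Ideal.span {f : XringF n |
    (∃ i : Fin n, (f : FRf n) = trcF (FreeGroup.of i) - 2) ∨
    (∃ i j : Fin n, i < j ∧ (f : FRf n) = trcF (FreeGroup.of i * FreeGroup.of j) - 2) ∨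
    (∃ i j k : Fin n, i < j ∧ j < k ∧
      (f : FRf n) = trcF (FreeGroup.of i * FreeGroup.of j * FreeGroup.of k) - 2)}

/-- The graded quotient `gr^k(J_{F_n}) = J_{F_n}^k / J_{F_n}^{k+1}`, realized as the image of
`J_{F_n}^k` in the ℚ-module quotient `𝔛_ℚ(F_n) / J_{F_n}^{k+1}`. -/
def grJF (n k : ℕ) : Submodule ℚ (XringF n ⧸ Submodule.restrictScalars ℚ (JF n ^ (k + 1))) :=
  (Submodule.restrictScalars ℚ (JF n ^ k)).map
    (Submodule.restrictScalars ℚ (JF n ^ (k + 1))).mkQ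

/-- The one-parameter subgroup of `SL(2,ℂ)` of diagonal matrices. -/
def diagHom : Multiplicative ℂ →* SL2 where
  toFun t := ⟨!![Complex.exp t.toAdd, 0; 0, Complex.exp (-t.toAdd)], by
    simp [Matrix.det_fin_two, ← Complex.exp_add]⟩
  map_one' := by
    ext i j
    fin_cases i <;> fin_cases j <;> simp
  map_mul' a b := by
    refine Subtype.ext ?_
    change _ = !![Complex.exp a.toAdd, 0; 0, Complex.exp (-a.toAdd)] *
      !![Complex.exp b.toAdd, 0; 0, Complex.exp (-b.toAdd)]
    simp [Complex.exp_add, mul_comm]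

lemma trace_diagHom (t : Multiplicative ℂ) :
    Matrix.trace (diagHom t : Matrix (Fin 2) (Fin 2) ℂ) =
      Complex.exp t.toAdd + Complex.exp (-t.toAdd) := by
  change Matrix.trace !![Complex.exp t.toAdd, 0; 0, Complex.exp (-t.toAdd)] = _
  simp [Matrix.trace_fin_two]

/-- The additive character of the free group with prescribed values on the generators. -/
def freeChar {n : ℕ} (s : Fin n → ℂ) : FreeGroup (Fin n) →* Multiplicative ℂ :=
  FreeGroup.lift fun i => Multiplicative.ofAdd (s i)

lemma freeChar_smul {n : ℕ} (ε : ℂ) (s : Fin n → ℂ) (x : FreeGroup (Fin n)) :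
    (freeChar (ε • s) x).toAdd = ε * (freeChar s x).toAdd := by
  have h : freeChar (ε • s) =
      (AddMonoidHom.toMultiplicative (AddMonoidHom.mulLeft ε)).comp (freeChar s) := by
    ext i
    simp [freeChar]
  rw [h]
  rfl

/-- The restriction of a function on the representation space to the line of diagonal
representations `x_i ↦ diag(exp(ε s_i), exp(-ε s_i))`. -/
def alongDiag {n : ℕ} (s : Fin n → ℂ) (f : FRf n) (ε : ℂ) : ℂ :=
  f (diagHom.comp (freeChar (ε • s)))

lemma alongDiag_trcF {n : ℕ} (s : Fin n → ℂ) (x : FreeGroup (Fin n)) (ε : ℂ) :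
    alongDiag s (trcF x) ε =
      Complex.exp (ε * (freeChar s x).toAdd) + Complex.exp (-(ε * (freeChar s x).toAdd)) := by
  rw [← freeChar_smul, ← trace_diagHom]
  rfl

lemma tendsto_exp_add_exp_neg_sub_two (t : ℂ) :
    Filter.Tendsto (fun ε : ℂ => (Complex.exp (ε * t) + Complex.exp (-(ε * t)) - 2) / ε ^ 2)
      (nhdsWithin 0 {0}ᶜ) (nhds (t ^ 2)) := by
  have hd : HasDerivAt (fun ε : ℂ => Complex.exp (ε * t)) t 0 := by
    simpa using ((hasDerivAt_id (0 : ℂ)).mul_const t).cexp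
  have h1 : Filter.Tendsto (fun ε : ℂ => ε⁻¹ * (Complex.exp (ε * t) - 1))
      (nhdsWithin 0 {0}ᶜ) (nhds t) := by
    simpa using hd.tendsto_slope_zero
  have h2 : Filter.Tendsto (fun ε : ℂ => Complex.exp (-(ε * t)))
      (nhdsWithin 0 {0}ᶜ) (nhds 1) := by
    have hc : Continuous fun ε : ℂ => Complex.exp (-(ε * t)) := by fun_prop
    simpa using (hc.tendsto 0).mono_left nhdsWithin_le_nhds
  refine Filter.Tendsto.congr (fun ε => ?_) (by simpa using h2.mul (h1.pow 2))
  have he : Complex.exp (-(ε * t)) * Complex.exp (ε * t) = 1 := by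
    rw [← Complex.exp_add]
    simp
  rw [mul_pow, inv_pow, div_eq_inv_mul]
  linear_combination (ε ^ 2)⁻¹ * (Complex.exp (ε * t) - 2) * he

lemma tendsto_alongDiag_trcF_sub_two {n : ℕ} (s : Fin n → ℂ) (x : FreeGroup (Fin n)) :
    Filter.Tendsto (fun ε => alongDiag s (trcF x - 2) ε / ε ^ 2) (nhdsWithin 0 {0}ᶜ)
      (nhds ((freeChar s x).toAdd ^ 2)) := by
  refine (tendsto_exp_add_exp_neg_sub_two _).congr fun ε => ?_
  rw [← alongDiag_trcF]
  rfl

lemma exists_tendsto_alongDiag {n : ℕ} (s : Fin n → ℂ) (f : XringF n) :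
    ∃ L, Filter.Tendsto (alongDiag s f) (nhdsWithin 0 {0}ᶜ) (nhds L) := by
  obtain ⟨f, hf⟩ := f
  induction hf using Algebra.adjoin_induction with
  | mem f hf =>
    obtain ⟨x, rfl⟩ := hf
    have hc : Continuous (alongDiag s (trcF x)) := by
      rw [funext (alongDiag_trcF s x)]
      fun_prop
    exact ⟨_, (hc.tendsto 0).mono_left nhdsWithin_le_nhds⟩
  | algebraMap r => exact ⟨_, tendsto_const_nhds⟩
  | add f g _ _ hf hg =>
    obtain ⟨L, hL⟩ := hf
    obtain ⟨M, hM⟩ := hg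
    exact ⟨_, hL.add hM⟩
  | mul f g _ _ hf hg =>
    obtain ⟨L, hL⟩ := hf
    obtain ⟨M, hM⟩ := hg
    exact ⟨_, hL.mul hM⟩

/-- The ideal of Fricke characters which vanish to order `2m` along a line of diagonal
representations. -/
def vanishingIdeal {n : ℕ} (s : Fin n → ℂ) (m : ℕ) : Ideal (XringF n) where
  carrier := {f | ∃ L, Filter.Tendsto (fun ε => alongDiag s f ε / ε ^ (2 * m))
    (nhdsWithin 0 {0}ᶜ) (nhds L)}
  add_mem' := by
    rintro f g ⟨L, hL⟩ ⟨M, hM⟩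
    exact ⟨_, (hL.add hM).congr fun ε => (add_div _ _ _).symm⟩
  zero_mem' := ⟨0, by simp [alongDiag]⟩
  smul_mem' := by
    rintro f g ⟨L, hL⟩
    obtain ⟨M, hM⟩ := exists_tendsto_alongDiag s f
    exact ⟨_, (hM.mul hL).congr fun ε => (mul_div_assoc _ _ _).symm⟩

lemma JF_le_vanishingIdeal {n : ℕ} (s : Fin n → ℂ) : JF n ≤ vanishingIdeal s 1 := by
  refine Ideal.span_le.2 ?_
  have key (f : XringF n) (x : FreeGroup (Fin n)) (hf : (f : FRf n) = trcF x - 2) :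
      f ∈ vanishingIdeal s 1 :=
    ⟨_, by simpa only [hf, mul_one] using tendsto_alongDiag_trcF_sub_two s x⟩
  rintro f (⟨i, hf⟩ | ⟨i, j, -, hf⟩ | ⟨i, j, k, -, -, hf⟩) <;>
    exact key f _ hf

lemma JF_pow_le_vanishingIdeal {n : ℕ} (s : Fin n → ℂ) (m : ℕ) :
    JF n ^ m ≤ vanishingIdeal s m := by
  induction m with
  | zero =>
    intro f _
    obtain ⟨L, hL⟩ := exists_tendsto_alongDiag s f
    exact ⟨L, by simpa using hL⟩
  | succ m ih =>
    rw [pow_succ, Ideal.mul_le]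
    intro f hf g hg
    obtain ⟨L, hL⟩ := ih hf
    obtain ⟨M, hM⟩ := JF_le_vanishingIdeal s hg
    refine ⟨L * M, (hL.mul hM).congr fun ε => ?_⟩
    rw [div_mul_div_comm, ← pow_add, ← mul_add]
    rfl

lemma tendsto_zero_of_mem_JF_pow_succ {n m : ℕ} (s : Fin n → ℂ) {f : XringF n}
    (hf : f ∈ JF n ^ (m + 1)) :
    Filter.Tendsto (fun ε => alongDiag s f ε / ε ^ (2 * m)) (nhdsWithin 0 {0}ᶜ) (nhds 0) := by
  obtain ⟨L, hL⟩ := JF_pow_le_vanishingIdeal s _ hf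
  have h2 : Filter.Tendsto (fun ε : ℂ => ε ^ 2) (nhdsWithin 0 {0}ᶜ) (nhds 0) := by
    simpa using ((continuous_pow 2).tendsto (0 : ℂ)).mono_left nhdsWithin_le_nhds
  have h := hL.mul h2
  rw [mul_zero] at h
  refine h.congr' ?_
  filter_upwards [self_mem_nhdsWithin] with ε hε
  have hε : ε ≠ 0 := hε
  field_simp
  ring

/-- The element `tr' x` of the ring of Fricke characters. -/
def trcSubTwo {n : ℕ} (x : FreeGroup (Fin n)) : XringF n :=
  ⟨trcF x, Algebra.subset_adjoin ⟨x, rfl⟩⟩ - 2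

lemma coe_trcSubTwo {n : ℕ} (x : FreeGroup (Fin n)) : (trcSubTwo x : FRf n) = trcF x - 2 := rfl

lemma exists_mem_JF_tendsto_mul_of_lt {n : ℕ} {i j : Fin n} (hij : i < j) :
    ∃ f ∈ JF n, ∀ s : Fin n → ℂ, Filter.Tendsto (fun ε => alongDiag s f ε / ε ^ 2)
      (nhdsWithin 0 {0}ᶜ) (nhds (s i * s j)) := by
  refine ⟨(1 / 2 : ℚ) • (trcSubTwo (FreeGroup.of i * FreeGroup.of j) -
    trcSubTwo (FreeGroup.of i) - trcSubTwo (FreeGroup.of j)), ?_, fun s => ?_⟩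
  · refine Submodule.smul_of_tower_mem _ _ (sub_mem (sub_mem ?_ ?_) ?_) <;>
      refine Ideal.subset_span ?_
    · exact Or.inr (Or.inl ⟨i, j, hij, rfl⟩)
    · exact Or.inl ⟨i, rfl⟩
    · exact Or.inl ⟨j, rfl⟩
  · have h := (((tendsto_alongDiag_trcF_sub_two s (FreeGroup.of i * FreeGroup.of j)).sub
      (tendsto_alongDiag_trcF_sub_two s (FreeGroup.of i))).sub
      (tendsto_alongDiag_trcF_sub_two s (FreeGroup.of j))).const_mul (1 / 2 : ℂ)
    have e : (1 / 2 : ℂ) * ((freeChar s (FreeGroup.of i * FreeGroup.of j)).toAdd ^ 2 -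
        (freeChar s (FreeGroup.of i)).toAdd ^ 2 - (freeChar s (FreeGroup.of j)).toAdd ^ 2) =
        s i * s j := by
      simp only [freeChar, map_mul, FreeGroup.lift_apply_of, toAdd_mul, toAdd_ofAdd]
      ring
    rw [e] at h
    refine h.congr fun ε => ?_
    simp only [alongDiag, Subalgebra.coe_smul, AddSubgroupClass.coe_sub,
      coe_trcSubTwo, Pi.smul_apply, Pi.sub_apply, Rat.smul_def]
    push_cast
    ring

lemma exists_mem_JF_tendsto_mul {n : ℕ} (i j : Fin n) :
    ∃ f ∈ JF n, ∀ s : Fin n → ℂ, Filter.Tendsto (fun ε => alongDiag s f ε / ε ^ 2)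
      (nhdsWithin 0 {0}ᶜ) (nhds (s i * s j)) := by
  rcases lt_trichotomy i j with h | rfl | h
  · exact exists_mem_JF_tendsto_mul_of_lt h
  · refine ⟨trcSubTwo (FreeGroup.of i), Ideal.subset_span (Or.inl ⟨i, rfl⟩), fun s => ?_⟩
    simpa [freeChar, sq, coe_trcSubTwo] using
      tendsto_alongDiag_trcF_sub_two s (FreeGroup.of i)
  · simpa only [mul_comm] using exists_mem_JF_tendsto_mul_of_lt h

lemma exists_mem_JF_pow_tendsto {n : ℕ} (k : ℕ) (m : Multiset (Fin n))
    (hm : m.card = 2 * k) :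
    ∃ f : XringF n, f ∈ JF n ^ k ∧ ∀ s : Fin n → ℂ,
      Filter.Tendsto (fun ε => alongDiag s f ε / ε ^ (2 * k))
        (nhdsWithin 0 {0}ᶜ) (nhds (m.map s).prod) := by
  induction k generalizing m with
  | zero =>
    obtain rfl : m = 0 := Multiset.card_eq_zero.1 hm
    exact ⟨1, by simp, fun s => by simp [alongDiag]⟩
  | succ k ih =>
    obtain ⟨i, m, rfl⟩ := Multiset.card_pos_iff_exists_mem.1 (by omega : 0 < m.card) |>.imp
      fun i hi => Multiset.exists_cons_of_mem hi
    rw [Multiset.card_cons] at hm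
    obtain ⟨j, m, rfl⟩ := Multiset.card_pos_iff_exists_mem.1 (by omega : 0 < m.card) |>.imp
      fun i hi => Multiset.exists_cons_of_mem hi
    rw [Multiset.card_cons] at hm
    obtain ⟨f, hf, hfl⟩ := ih m (by omega)
    obtain ⟨g, hg, hgl⟩ := exists_mem_JF_tendsto_mul i j
    refine ⟨f * g, pow_succ (JF n) k ▸ Ideal.mul_mem_mul hf hg, fun s => ?_⟩
    have h := (hfl s).mul (hgl s)
    simp only [Multiset.map_cons, Multiset.prod_cons]
    rw [← mul_assoc, mul_comm (s i * s j)]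
    refine h.congr fun ε => ?_
    rw [div_mul_div_comm, ← pow_add]
    rfl

lemma eq_zero_of_sum_smul_prod_eq_zero {σ ι : Type*} [Fintype ι] {g : ι → Multiset σ}
    (hg : Function.Injective g) {c : ι → ℚ}
    (h : ∀ s : σ → ℂ, ∑ x, (c x : ℂ) * ((g x).map s).prod = 0) (x : ι) : c x = 0 := by
  classical
  have hp : ∑ x, MvPolynomial.monomial (Multiset.toFinsupp (g x)) (c x : ℂ) = 0 := by
    refine MvPolynomial.funext fun s => ?_
    rw [map_sum, map_zero, ← h s]
    refine Finset.sum_congr rfl fun x _ => ?_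
    rw [MvPolynomial.eval_monomial, Finset.prod_multiset_map_count]
    simp [Finsupp.prod]
  have hx := congrArg (MvPolynomial.coeff (Multiset.toFinsupp (g x))) hp
  simpa [MvPolynomial.coeff_sum, MvPolynomial.coeff_monomial, hg.eq_iff] using hx

/-- Pairs consisting of a set of `2l` indices and a multiset of `k - l` indices. -/
abbrev ParityIndex (n k : ℕ) : Type :=
  Σ l : Fin (k + 1), Finset.powersetCard (2 * (l : ℕ)) (Finset.univ : Finset (Fin n)) ×
    Sym (Fin n) (k - l)

namespace ParityIndex

variable {n k : ℕ}

lemma card_eq : Fintype.card (ParityIndex n k) =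
    ∑ l ∈ Finset.range (k + 1), Nat.choose n (2 * l) * Nat.choose (n + k - l - 1) (k - l) := by
  rw [Fintype.card_sigma, Finset.sum_range]
  refine Finset.sum_congr rfl fun l _ => ?_
  rw [Fintype.card_prod, Fintype.card_coe, Finset.card_powersetCard, Finset.card_fin,
    Sym.card_sym_eq_choose, Fintype.card_fin, Nat.add_sub_assoc (Nat.le_of_lt_succ l.2)]

/-- The multiset in which the given set records the indices of odd multiplicity. -/
def toMultiset (x : ParityIndex n k) : Multiset (Fin n) :=
  2 • (x.2.2 : Multiset (Fin n)) + x.2.1.1.val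

lemma card_toMultiset (x : ParityIndex n k) : x.toMultiset.card = 2 * k := by
  obtain ⟨l, ⟨S, hS⟩, a⟩ := x
  have h1 := (Finset.mem_powersetCard.1 hS).2
  have h2 := l.2
  simp only [toMultiset, Multiset.card_add, Multiset.card_nsmul, Sym.card_coe, Finset.card_val]
  omega

lemma toMultiset_injective : Function.Injective (toMultiset : ParityIndex n k → _) := by
  rintro ⟨l, ⟨S, hS⟩, a⟩ ⟨l', ⟨S', hS'⟩, a'⟩ h
  have hc (i : Fin n) : 2 * (a : Multiset (Fin n)).count i + S.val.count i =
      2 * (a' : Multiset (Fin n)).count i + S'.val.count i := by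
    simpa [toMultiset] using congrArg (Multiset.count i) h
  have hle (T : Finset (Fin n)) (i : Fin n) : T.val.count i ≤ 1 :=
    Multiset.nodup_iff_count_le_one.1 T.nodup i
  have hSS : S = S' := by
    refine Finset.val_injective (Multiset.ext.2 fun i => ?_)
    have := hc i
    have := hle S i
    have := hle S' i
    omega
  subst hSS
  obtain rfl : l = l' := by
    have h1 := (Finset.mem_powersetCard.1 hS).2
    have h2 := (Finset.mem_powersetCard.1 hS').2
    exact Fin.ext (by omega)
  obtain rfl : a = a' := Sym.coe_injective (Multiset.ext.2 fun i => by have := hc i; omega)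
  rfl

end ParityIndex

/-- **Corollary 1.2**: for every `n ≥ 2` and `k ≥ 1`, the ℚ-dimension of `gr^k(J_{F_n})` is at
least `Σ_{l=0}^{k} C(n,2l)·C(n+k-l-1, k-l)`. -/
theorem rank_grJF_ge (n : ℕ) (hn : 2 ≤ n) (k : ℕ) (hk : 1 ≤ k) :
    ((∑ l ∈ Finset.range (k + 1),
        Nat.choose n (2 * l) * Nat.choose (n + k - l - 1) (k - l) : ℕ) : Cardinal)
      ≤ Module.rank ℚ (grJF n k) := by
  classical
  choose F hFJ hFlim using exists_mem_JF_pow_tendsto (n := n) k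
  let v : ParityIndex n k → grJF n k := fun x =>
    ⟨_, Submodule.mem_map_of_mem (hFJ x.toMultiset x.card_toMultiset)⟩
  have hv : LinearIndependent ℚ v := by
    rw [Fintype.linearIndependent_iff]
    intro c hc
    have hmem : ∑ x, c x • F x.toMultiset x.card_toMultiset ∈ JF n ^ (k + 1) := by
      have h := congrArg Subtype.val hc
      simp only [v, Submodule.coe_sum, Submodule.coe_smul, ← map_smul, ← map_sum,
        Submodule.coe_zero] at h
      simpa using (Submodule.Quotient.mk_eq_zero _).1 h
    apply eq_zero_of_sum_smul_prod_eq_zero ParityIndex.toMultiset_injective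
    intro s
    have h0 := tendsto_zero_of_mem_JF_pow_succ s hmem
    refine tendsto_nhds_unique (Filter.Tendsto.congr (fun ε => ?_)
      (tendsto_finsetSum Finset.univ fun x _ =>
        (hFlim x.toMultiset x.card_toMultiset s).const_mul (c x : ℂ))) h0
    simp [alongDiag, Finset.sum_div, Finset.sum_apply, Rat.smul_def, mul_div_assoc]
  have h := hv.cardinal_le_rank
  rwa [Cardinal.mk_fintype, ParityIndex.card_eq] at h
end
end
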